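/- arXiv:1201.1377 — 3 statements merged into one kernel-verified Lean document; each statement's English description precedes it below -/
import Mathlib

section
/- There exists a constant c > 0 such that the following holds for all sufficiently large n: every depth-two n-superconcentrator G = (V, M, W, E) has at least c · n · (log n)² / log log n edges. -/
/-- A depth-two `n`-superconcentrator: a graph on `V = Fin n`, `M = Fin m`,
`W = Fin n` with edge sets `E1` (from `V` to `M`) and `E2` (from `M` to `W`) such
that for every `k ∈ {1, …, n}` and every pair of subsets `S ⊆ V`, `T ⊆ W` of size
`k`, there are `k` vertex-disjoint paths `v–m–w` from `S` to `T`. -/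
def IsDepthTwoSC (n m : ℕ) (E1 : Finset (Fin n × Fin m)) (E2 : Finset (Fin m × Fin n)) :
    Prop :=
  ∀ k : ℕ, 1 ≤ k → k ≤ n → ∀ S T : Finset (Fin n), S.card = k → T.card = k →
    ∃ (vs : Fin k → Fin n) (ms : Fin k → Fin m) (ws : Fin k → Fin n),
      Function.Injective vs ∧ Function.Injective ms ∧ Function.Injective ws ∧
      ∀ j, vs j ∈ S ∧ ws j ∈ T ∧ (vs j, ms j) ∈ E1 ∧ (ms j, ws j) ∈ E2

open Finset in
/-- Among the `k`-element subsets of `A` there is one whose total weight is at most average. -/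
theorem exists_subset_card_mul_sum_le {α : Type*} [DecidableEq α] (f : α → ℕ) (k : ℕ)
    (A : Finset α) (hk : k ≤ #A) :
    ∃ S ⊆ A, #S = k ∧ #A * ∑ v ∈ S, f v ≤ k * ∑ v ∈ A, f v := by
  induction A using Finset.strongInduction with
  | H A ih =>
    rcases hk.eq_or_lt with rfl | hlt
    · exact ⟨A, Subset.rfl, rfl, le_rfl⟩
    rcases Nat.eq_zero_or_pos k with rfl | hpos
    · exact ⟨∅, by simp, by simp, by simp⟩
    have hA : A.Nonempty := card_pos.mp (by omega)
    obtain ⟨a, ha, hmax⟩ := exists_max_image A f hA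
    have hcard : #(A.erase a) + 1 = #A := card_erase_add_one ha
    obtain ⟨S, hSA, hS, hle⟩ := ih (A.erase a) (erase_ssubset ha) (by omega)
    refine ⟨S, hSA.trans (erase_subset _ _), hS, ?_⟩
    have hsum : ∑ v ∈ A.erase a, f v ≤ #(A.erase a) * f a := by
      rw [← smul_eq_mul]
      exact sum_le_card_nsmul _ _ _ fun v hv => hmax v (mem_of_mem_erase hv)
    rw [← sum_erase_add A f ha, ← hcard]
    have hb : 0 < #(A.erase a) := by omega
    refine Nat.le_of_mul_le_mul_left ?_ hb
    calc #(A.erase a) * ((#(A.erase a) + 1) * ∑ v ∈ S, f v)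
        = (#(A.erase a) + 1) * (#(A.erase a) * ∑ v ∈ S, f v) := by ring
      _ ≤ (#(A.erase a) + 1) * (k * ∑ v ∈ A.erase a, f v) := Nat.mul_le_mul_left _ hle
      _ = k * (#(A.erase a) * ∑ v ∈ A.erase a, f v + ∑ v ∈ A.erase a, f v) := by ring
      _ ≤ k * (#(A.erase a) * ∑ v ∈ A.erase a, f v + #(A.erase a) * f a) := by gcongr
      _ = #(A.erase a) * (k * (∑ v ∈ A.erase a, f v + f a)) := by ring

open Finset in
/-- Two sides of a weighted bipartite graph contain `k`-element subsets spanning at most the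
average weight. -/
theorem exists_subsets_card_mul_sum_le {α β : Type*} [DecidableEq α] [DecidableEq β]
    (g : α → β → ℕ) (k : ℕ) (A : Finset α) (B : Finset β) (hA : k ≤ #A) (hB : k ≤ #B) :
    ∃ S ⊆ A, ∃ T ⊆ B, #S = k ∧ #T = k ∧
      #A * #B * ∑ v ∈ S, ∑ w ∈ T, g v w ≤ k * k * ∑ v ∈ A, ∑ w ∈ B, g v w := by
  obtain ⟨S, hSA, hS, h1⟩ := exists_subset_card_mul_sum_le (fun v => ∑ w ∈ B, g v w) k A hA
  obtain ⟨T, hTB, hT, h2⟩ := exists_subset_card_mul_sum_le (fun w => ∑ v ∈ S, g v w) k B hB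
  refine ⟨S, hSA, T, hTB, hS, hT, ?_⟩
  rw [sum_comm (s := S)]
  rw [sum_comm (s := B) (t := S)] at h2
  calc #A * #B * ∑ w ∈ T, ∑ v ∈ S, g v w
      = #A * (#B * ∑ w ∈ T, ∑ v ∈ S, g v w) := by ring
    _ ≤ #A * (k * ∑ v ∈ S, ∑ w ∈ B, g v w) := Nat.mul_le_mul_left _ h2
    _ = k * (#A * ∑ v ∈ S, ∑ w ∈ B, g v w) := by ring
    _ ≤ k * (k * ∑ v ∈ A, ∑ w ∈ B, g v w) := Nat.mul_le_mul_left _ h1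
    _ = _ := by ring

open Finset in
/-- The number of subsets containing `A` and missing `B`. -/
theorem card_filter_subset_disjoint {Ω : Type*} [Fintype Ω] [DecidableEq Ω] (A B : Finset Ω) :
    #{U : Finset Ω | A ⊆ U ∧ Disjoint U B} =
      if Disjoint A B then 2 ^ (Fintype.card Ω - (#A + #B)) else 0 := by
  split_ifs with h
  · have : ({U : Finset Ω | A ⊆ U ∧ Disjoint U B} : Finset (Finset Ω)) = Icc A Bᶜ := by
      ext U
      simp [subset_compl_iff_disjoint_right]
    rw [this, card_Icc_finset (subset_compl_iff_disjoint_right.mpr h), card_compl]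
    congr 1
    omega
  · rw [card_eq_zero, filter_eq_empty_iff]
    rintro U - ⟨h1, h2⟩
    exact h (h2.mono_left h1)

open Finset in
/-- Exchanging a sum over random subsets `U` with a sum over the pairs selected by `U`. -/
theorem sum_selected_pairs {α β Ω : Type*} [Fintype Ω] [DecidableEq Ω]
    (V : Finset α) (W : Finset β) (A : α → Finset Ω) (B : β → Finset Ω) (D : ℕ)
    (hA : ∀ v ∈ V, #(A v) = D) (hB : ∀ w ∈ W, #(B w) = D) (g : α → β → ℕ) :
    ∑ U : Finset Ω, ∑ v ∈ V with A v ⊆ U, ∑ w ∈ W with Disjoint U (B w), g v w =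
      2 ^ (Fintype.card Ω - 2 * D) *
        ∑ v ∈ V, ∑ w ∈ W, if Disjoint (A v) (B w) then g v w else 0 := by
  have h1 : ∀ U : Finset Ω,
      ∑ v ∈ V with A v ⊆ U, ∑ w ∈ W with Disjoint U (B w), g v w =
        ∑ v ∈ V, ∑ w ∈ W, if A v ⊆ U ∧ Disjoint U (B w) then g v w else 0 := by
    intro U
    rw [sum_filter]
    refine sum_congr rfl fun v _ => ?_
    by_cases h : A v ⊆ U
    · simp [h, sum_filter]
    · simp [h]
  simp_rw [h1]
  rw [sum_comm, mul_sum]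
  refine sum_congr rfl fun v hv => ?_
  rw [sum_comm, mul_sum]
  refine sum_congr rfl fun w hw => ?_
  rw [← sum_filter, sum_const, card_filter_subset_disjoint, hA v hv, hB w hw, smul_eq_mul,
    ← two_mul]
  split_ifs <;> simp

open Finset in
/-- If every pair of `k`-sets whose members have pairwise disjoint labels spans `H`-weight at
least `k / 2`, then few pairs have disjoint labels, unless `H` is heavy. -/
theorem card_disjoint_pairs_le_of_card_eq {α β Ω : Type*} [DecidableEq α] [DecidableEq β]
    [Fintype Ω] [DecidableEq Ω]
    (V : Finset α) (W : Finset β) (A : α → Finset Ω) (B : β → Finset Ω) (D N k : ℕ)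
    (hA : ∀ v ∈ V, #(A v) = D) (hB : ∀ w ∈ W, #(B w) = D) (hΩ : 2 * D ≤ Fintype.card Ω)
    (hV : #V ≤ N) (hW : #W ≤ N) (hk : 0 < k) (g : α → β → ℕ)
    (hg : ∀ S ⊆ V, ∀ T ⊆ W, #S = k → #T = k → (∀ v ∈ S, ∀ w ∈ T, Disjoint (A v) (B w)) →
      k ≤ 2 * ∑ v ∈ S, ∑ w ∈ T, g v w) :
    (∑ v ∈ V, ∑ w ∈ W, if Disjoint (A v) (B w) then 1 else 0) ≤
      2 * k * (∑ v ∈ V, ∑ w ∈ W, g v w) + k * N * 4 ^ D := by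
  have key : ∀ U : Finset Ω,
      (∑ v ∈ V with A v ⊆ U, ∑ w ∈ W with Disjoint U (B w), 1) ≤
        2 * k * (∑ v ∈ V with A v ⊆ U, ∑ w ∈ W with Disjoint U (B w), g v w) + k * N := by
    intro U
    set X := V.filter fun v => A v ⊆ U with hX
    set Y := W.filter fun w => Disjoint U (B w) with hY
    have hXN : #X ≤ N := (card_filter_le _ _).trans hV
    have hYN : #Y ≤ N := (card_filter_le _ _).trans hW
    have hXY : ∑ v ∈ X, ∑ w ∈ Y, 1 = #X * #Y := by simp
    rw [hXY]
    by_cases hXk : k ≤ #X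
    · by_cases hYk : k ≤ #Y
      · obtain ⟨S, hSX, T, hTY, hS, hT, hle⟩ :=
          exists_subsets_card_mul_sum_le g k X Y hXk hYk
        have := hg S (hSX.trans (filter_subset _ _)) T (hTY.trans (filter_subset _ _)) hS hT
          fun v hv w hw => (mem_filter.mp (hTY hw)).2.mono_left (mem_filter.mp (hSX hv)).2
        refine le_add_right (Nat.le_of_mul_le_mul_left ?_ hk)
        calc k * (#X * #Y) ≤ (2 * ∑ v ∈ S, ∑ w ∈ T, g v w) * (#X * #Y) :=
              Nat.mul_le_mul_right _ this
          _ = 2 * (#X * #Y * ∑ v ∈ S, ∑ w ∈ T, g v w) := by ring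
          _ ≤ 2 * (k * k * ∑ v ∈ X, ∑ w ∈ Y, g v w) := Nat.mul_le_mul_left _ hle
          _ = _ := by ring
      · refine le_add_left ?_
        rw [mul_comm]
        exact Nat.mul_le_mul (by omega) hXN
    · exact le_add_left (Nat.mul_le_mul (by omega) hYN)
  have hsum := sum_le_sum fun U (_ : U ∈ (univ : Finset (Finset Ω))) => key U
  rw [sum_add_distrib, ← mul_sum, sum_selected_pairs V W A B D hA hB,
    sum_selected_pairs V W A B D hA hB, sum_const, card_univ, Fintype.card_finset,
    smul_eq_mul] at hsum
  have hpow : 2 ^ Fintype.card Ω = 2 ^ (Fintype.card Ω - 2 * D) * 4 ^ D := by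
    rw [show (4 : ℕ) = 2 ^ 2 by norm_num, ← pow_mul, ← pow_add]
    congr 1
    omega
  have hdrop : (∑ v ∈ V, ∑ w ∈ W, if Disjoint (A v) (B w) then g v w else 0) ≤
      ∑ v ∈ V, ∑ w ∈ W, g v w := by
    gcongr
    split_ifs <;> simp
  refine Nat.le_of_mul_le_mul_left ?_ (pow_pos two_pos (Fintype.card Ω - 2 * D))
  calc _ ≤ _ := hsum
    _ ≤ 2 * k * (2 ^ (Fintype.card Ω - 2 * D) * ∑ v ∈ V, ∑ w ∈ W, g v w) +
        2 ^ (Fintype.card Ω - 2 * D) * 4 ^ D * (k * N) := by rw [hpow]; gcongr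
    _ = _ := by ring

open Finset in
/-- The same bound when the labels only have at most `D` elements, by padding them with private
elements. -/
theorem card_disjoint_pairs_le {α β Ω : Type*} [Fintype α] [Fintype β] [Nonempty α] [Nonempty β]
    [DecidableEq α] [DecidableEq β] [Fintype Ω] [DecidableEq Ω]
    (V : Finset α) (W : Finset β) (A : α → Finset Ω) (B : β → Finset Ω) (D N k : ℕ)
    (hA : ∀ v ∈ V, #(A v) ≤ D) (hB : ∀ w ∈ W, #(B w) ≤ D)
    (hV : #V ≤ N) (hW : #W ≤ N) (hk : 0 < k) (g : α → β → ℕ)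
    (hg : ∀ S ⊆ V, ∀ T ⊆ W, #S = k → #T = k → (∀ v ∈ S, ∀ w ∈ T, Disjoint (A v) (B w)) →
      k ≤ 2 * ∑ v ∈ S, ∑ w ∈ T, g v w) :
    (∑ v ∈ V, ∑ w ∈ W, if Disjoint (A v) (B w) then 1 else 0) ≤
      2 * k * (∑ v ∈ V, ∑ w ∈ W, g v w) + k * N * 4 ^ D := by
  let A' : α → Finset (Ω ⊕ (α ⊕ β) × Fin D) := fun v =>
    (A v).disjSum ({Sum.inl v} ×ˢ univ.filter fun j : Fin D => (j : ℕ) < D - #(A v))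
  let B' : β → Finset (Ω ⊕ (α ⊕ β) × Fin D) := fun w =>
    (B w).disjSum ({Sum.inr w} ×ˢ univ.filter fun j : Fin D => (j : ℕ) < D - #(B w))
  have hdisj : ∀ v w, Disjoint (A' v) (B' w) ↔ Disjoint (A v) (B w) := by
    intro v w
    simp only [A', B', disjoint_left]
    constructor
    · intro h x hx hx'
      exact h (inl_mem_disjSum.mpr hx) (inl_mem_disjSum.mpr hx')
    · rintro h (x | ⟨x, j⟩) hx hx'
      · exact h (inl_mem_disjSum.mp hx) (inl_mem_disjSum.mp hx')
      · simp only [inr_mem_disjSum, mem_product, mem_singleton] at hx hx'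
        simp [hx.1] at hx'
  have hcard : ∀ a ≤ D, a + #{j : Fin D | (j : ℕ) < D - a} = D := by
    intro a ha
    rw [Fin.card_filter_val_lt]
    omega
  have := card_disjoint_pairs_le_of_card_eq V W A' B' D N k
    (fun v hv => by simpa [A', card_disjSum] using hcard _ (hA v hv))
    (fun w hw => by simpa [B', card_disjSum] using hcard _ (hB w hw))
    (by
      have h1 := Fintype.card_pos (α := α)
      have h2 := Fintype.card_pos (α := β)
      simp only [Fintype.card_sum, Fintype.card_prod, Fintype.card_fin]
      nlinarith) hV hW hk g
    (fun S hS T hT h1 h2 h3 => hg S hS T hT h1 h2 fun v hv w hw => (hdisj v w).mp (h3 v hv w hw))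
  simpa only [hdisj] using this

/-- The number of edges at a middle vertex. -/
def midDegree {n m : ℕ} (E1 : Finset (Fin n × Fin m)) (E2 : Finset (Fin m × Fin n))
    (x : Fin m) : ℕ :=
  (Finset.univ.filter fun v => (v, x) ∈ E1).card + (Finset.univ.filter fun w => (x, w) ∈ E2).card

section

open Finset

variable {n m : ℕ} (E1 : Finset (Fin n × Fin m)) (E2 : Finset (Fin m × Fin n))

theorem sum_midDegree : ∑ x, midDegree E1 E2 x = #E1 + #E2 := by
  simp only [midDegree, sum_add_distrib, card_filter]
  congr 1
  · rw [← Fintype.sum_prod_type_right (f := fun p => if p ∈ E1 then 1 else 0)]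
    simp
  · rw [← Fintype.sum_prod_type (f := fun p => if p ∈ E2 then 1 else 0)]
    simp

/-- Middle vertices of degree at most `t` join few pairs. -/
theorem sum_connected_le (P : Finset (Fin m)) (t : ℕ) (ht : ∀ x ∈ P, midDegree E1 E2 x ≤ t)
    (V W : Finset (Fin n)) :
    (∑ v ∈ V, ∑ w ∈ W, if ∃ x ∈ P, (v, x) ∈ E1 ∧ (x, w) ∈ E2 then 1 else 0) ≤
      t * (#E1 + #E2) := by
  calc (∑ v ∈ V, ∑ w ∈ W, if ∃ x ∈ P, (v, x) ∈ E1 ∧ (x, w) ∈ E2 then 1 else 0)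
      ≤ ∑ v ∈ V, ∑ w ∈ W, ∑ x ∈ P,
          (if (v, x) ∈ E1 then 1 else 0) * (if (x, w) ∈ E2 then 1 else 0) := by
        gcongr with v _ w _
        split_ifs with h
        · obtain ⟨x, hx, h1, h2⟩ := h
          refine le_trans ?_ (single_le_sum (fun _ _ => Nat.zero_le _) hx)
          simp [h1, h2]
        · exact Nat.zero_le _
    _ ≤ ∑ v, ∑ w, ∑ x ∈ P,
          (if (v, x) ∈ E1 then 1 else 0) * (if (x, w) ∈ E2 then 1 else 0) := by
        refine (sum_le_sum fun v _ => ?_).trans (sum_le_sum_of_subset (subset_univ V))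
        exact sum_le_sum_of_subset (subset_univ W)
    _ = ∑ x ∈ P, ∑ v, ∑ w,
          (if (v, x) ∈ E1 then 1 else 0) * (if (x, w) ∈ E2 then 1 else 0) := by
        rw [sum_comm (s := P)]
        refine sum_congr rfl fun v _ => ?_
        rw [sum_comm]
    _ = ∑ x ∈ P, #{v | (v, x) ∈ E1} * #{w | (x, w) ∈ E2} := by
        refine sum_congr rfl fun x _ => ?_
        rw [card_filter, card_filter, sum_mul_sum]
    _ ≤ ∑ x ∈ P, t * midDegree E1 E2 x := by
        refine sum_le_sum fun x hx => Nat.mul_le_mul ?_ ?_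
        · exact (Nat.le_add_right _ _).trans (ht x hx)
        · exact Nat.le_add_left _ _
    _ ≤ ∑ x, t * midDegree E1 E2 x := sum_le_sum_of_subset (subset_univ P)
    _ = t * (#E1 + #E2) := by rw [← mul_sum, sum_midDegree]

/-- Markov's inequality for the size of the fibres of a relation. -/
theorem succ_mul_card_large_fibres_le {α β : Type*} [Fintype α] (r : α → β → Prop)
    [∀ a b, Decidable (r a b)] (P : Finset β) (D : ℕ) (f : β → ℕ)
    (hf : ∀ x ∈ P, #{v | r v x} ≤ f x) :
    (D + 1) * #{v | ¬ #(P.filter fun x => r v x) ≤ D} ≤ ∑ x ∈ P, f x := by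
  calc (D + 1) * #{v | ¬ #(P.filter fun x => r v x) ≤ D}
      = ∑ v with ¬ #(P.filter fun x => r v x) ≤ D, (D + 1) := by
        rw [sum_const, smul_eq_mul, mul_comm]
    _ ≤ ∑ v with ¬ #(P.filter fun x => r v x) ≤ D, #(P.filter fun x => r v x) := by
        refine sum_le_sum fun v hv => ?_
        have := (mem_filter.mp hv).2
        omega
    _ ≤ ∑ v, #(P.filter fun x => r v x) := sum_le_sum_of_subset (subset_univ _)
    _ = ∑ x ∈ P, #{v | r v x} := by
        simp only [card_filter]
        exact sum_comm
    _ ≤ ∑ x ∈ P, f x := sum_le_sum hf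

variable {E1 E2}

/-- Disjoint paths through vertices outside `Q` give distinct connected pairs. -/
theorem IsDepthTwoSC.le_card_add_sum_connected (h : IsDepthTwoSC n m E1 E2) {k : ℕ} (hk : 0 < k)
    (P Q : Finset (Fin m)) (S T : Finset (Fin n)) (hS : #S = k) (hT : #T = k)
    (hPQ : ∀ v ∈ S, ∀ w ∈ T, ∀ x, (v, x) ∈ E1 → (x, w) ∈ E2 → x ∈ P ∨ x ∈ Q) :
    k ≤ #Q + ∑ v ∈ S, ∑ w ∈ T, if ∃ x ∈ P, (v, x) ∈ E1 ∧ (x, w) ∈ E2 then 1 else 0 := by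
  have hkn : k ≤ n := by simpa [hS] using card_le_univ S
  obtain ⟨vs, ms, ws, hvs, hms, hws, hpath⟩ := h k hk hkn S T hS hT
  have h1 : #{j | ms j ∈ Q} ≤ #Q :=
    card_le_card_of_injOn ms (fun j hj => by simpa using hj) hms.injOn
  have h2 : #{j | ¬ ms j ∈ Q} ≤
      #((S ×ˢ T).filter fun p => ∃ x ∈ P, (p.1, x) ∈ E1 ∧ (x, p.2) ∈ E2) := by
    refine card_le_card_of_injOn (fun j => (vs j, ws j)) (fun j hj => ?_)
      (fun i _ j _ hij => hvs (Prod.ext_iff.mp hij).1)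
    obtain ⟨hv, hw, he1, he2⟩ := hpath j
    have hj' : ms j ∉ Q := by simpa using hj
    have hP := (hPQ _ hv _ hw _ he1 he2).resolve_right hj'
    simp only [coe_filter, mem_product, Set.mem_ofPred_eq]
    exact ⟨⟨hv, hw⟩, ms j, hP, he1, he2⟩
  rw [card_filter (fun p : Fin n × Fin n => ∃ x ∈ P, (p.1, x) ∈ E1 ∧ (x, p.2) ∈ E2) (S ×ˢ T),
    sum_product] at h2
  dsimp only at h2
  have h3 := card_filter_add_card_filter_not (s := (univ : Finset (Fin k))) fun j => ms j ∈ Q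
  rw [card_univ, Fintype.card_fin] at h3
  omega

/-- The middle vertices whose degree lies in a suitable window carry many edges. -/
theorem IsDepthTwoSC.lt_sum_midDegree_window (h : IsDepthTwoSC n m E1 E2) (hn : 0 < n)
    (lo hi k D : ℕ) (hk : 0 < k) (hhi0 : 0 < hi) (hhi : 2 * (#E1 + #E2) ≤ k * hi)
    (hlow : 16 * (2 * k * (lo * (#E1 + #E2))) ≤ 2 * n ^ 2)
    (hmed : 16 * (hi * (#E1 + #E2)) ≤ n ^ 2) (hkn : 16 * (k * n * 4 ^ D) ≤ n ^ 2) :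
    (D + 1) * n < 4 * ∑ x with lo ≤ midDegree E1 E2 x ∧ midDegree E1 E2 x < hi,
      midDegree E1 E2 x := by
  by_contra! hμ
  have : Nonempty (Fin n) := ⟨⟨0, hn⟩⟩
  set Med : Finset (Fin m) := {x | lo ≤ midDegree E1 E2 x ∧ midDegree E1 E2 x < hi} with hMed
  set Low : Finset (Fin m) := {x | midDegree E1 E2 x < lo} with hLow
  set High : Finset (Fin m) := {x | hi ≤ midDegree E1 E2 x} with hHigh
  let A : Fin n → Finset (Fin m) := fun v => Med.filter fun x => (v, x) ∈ E1
  let B : Fin n → Finset (Fin m) := fun w => Med.filter fun x => (x, w) ∈ E2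
  let V : Finset (Fin n) := {v | #(A v) ≤ D}
  let W : Finset (Fin n) := {w | #(B w) ≤ D}
  have hV : 3 * n ≤ 4 * #V := by
    have h1 := succ_mul_card_large_fibres_le (fun v x => (v, x) ∈ E1) Med D (midDegree E1 E2)
      fun x _ => Nat.le_add_right _ _
    have h2 := card_filter_add_card_filter_not (s := (univ : Finset (Fin n)))
      fun v => #(A v) ≤ D
    rw [card_univ, Fintype.card_fin] at h2
    have h3 : 4 * #{v | ¬ #(A v) ≤ D} ≤ n := by
      refine Nat.le_of_mul_le_mul_left ?_ D.succ_pos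
      calc (D + 1) * (4 * #{v | ¬ #(A v) ≤ D}) = 4 * ((D + 1) * #{v | ¬ #(A v) ≤ D}) := by ring
        _ ≤ _ := (Nat.mul_le_mul_left _ h1).trans hμ
    change #V + _ = n at h2
    omega
  have hW : 3 * n ≤ 4 * #W := by
    have h1 := succ_mul_card_large_fibres_le (fun w x => (x, w) ∈ E2) Med D (midDegree E1 E2)
      fun x _ => Nat.le_add_left _ _
    have h2 := card_filter_add_card_filter_not (s := (univ : Finset (Fin n)))
      fun w => #(B w) ≤ D
    rw [card_univ, Fintype.card_fin] at h2
    have h3 : 4 * #{w | ¬ #(B w) ≤ D} ≤ n := by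
      refine Nat.le_of_mul_le_mul_left ?_ D.succ_pos
      calc (D + 1) * (4 * #{w | ¬ #(B w) ≤ D}) = 4 * ((D + 1) * #{w | ¬ #(B w) ≤ D}) := by ring
        _ ≤ _ := (Nat.mul_le_mul_left _ h1).trans hμ
    change #W + _ = n at h2
    omega
  have hHighcard : 2 * #High ≤ k := by
    have h1 : #High * hi ≤ #E1 + #E2 := by
      rw [← sum_midDegree, ← smul_eq_mul]
      exact (card_nsmul_le_sum _ _ _ fun x hx => (mem_filter.mp hx).2).trans
        (sum_le_sum_of_subset (subset_univ _))
    refine Nat.le_of_mul_le_mul_right ?_ hhi0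
    linarith
  have hmain := card_disjoint_pairs_le V W A B D n k
    (fun v hv => (mem_filter.mp hv).2) (fun w hw => (mem_filter.mp hw).2)
    (by simpa using card_le_univ V) (by simpa using card_le_univ W) hk
    (fun v w => if ∃ x ∈ Low, (v, x) ∈ E1 ∧ (x, w) ∈ E2 then 1 else 0)
    (by
      intro S _ T _ hS hT hST
      have := h.le_card_add_sum_connected hk Low High S T hS hT fun v hv w hw x h1 h2 => by
        by_contra! hx
        simp only [hLow, hHigh, mem_filter, mem_univ, true_and, not_lt, not_le] at hx
        have hxM : x ∈ Med := by simpa [hMed] using hx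
        exact disjoint_left.mp (hST v hv w hw) (mem_filter.mpr ⟨hxM, h1⟩)
          (mem_filter.mpr ⟨hxM, h2⟩)
      omega)
  have hLowpairs := sum_connected_le E1 E2 Low lo (fun x hx => (mem_filter.mp hx).2.le) V W
  have hMedpairs := sum_connected_le E1 E2 Med hi (fun x hx => (mem_filter.mp hx).2.2.le) V W
  have hsplit : #V * #W ≤ (∑ v ∈ V, ∑ w ∈ W, if Disjoint (A v) (B w) then 1 else 0) +
      ∑ v ∈ V, ∑ w ∈ W, if ∃ x ∈ Med, (v, x) ∈ E1 ∧ (x, w) ∈ E2 then 1 else 0 := by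
    have : #V * #W = ∑ v ∈ V, ∑ w ∈ W, 1 := by simp
    rw [this, ← sum_add_distrib]
    refine sum_le_sum fun v _ => ?_
    rw [← sum_add_distrib]
    refine sum_le_sum fun w _ => ?_
    by_cases hd : Disjoint (A v) (B w)
    · simp [hd]
    · obtain ⟨x, hx1, hx2⟩ := not_disjoint_iff.mp hd
      obtain ⟨hxM, h1⟩ := mem_filter.mp hx1
      rw [if_pos (⟨x, hxM, h1, (mem_filter.mp hx2).2⟩ : ∃ x ∈ Med, (v, x) ∈ E1 ∧ (x, w) ∈ E2)]
      exact Nat.le_add_left _ _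
  have hlow' := Nat.mul_le_mul_left (2 * k) hLowpairs
  have hVW : (3 * n) * (3 * n) ≤ (4 * #V) * (4 * #W) := Nat.mul_le_mul hV hW
  have hn2 : 0 < n ^ 2 := pow_pos hn 2
  nlinarith

/-- Summing over disjoint windows of degrees. -/
theorem sum_window_le (R a b : ℕ) (hR : 1 ≤ R) :
    ∑ i ∈ Ico a b, (∑ x with R ^ i ≤ midDegree E1 E2 x ∧ midDegree E1 E2 x < R ^ (i + 1),
      midDegree E1 E2 x) ≤ #E1 + #E2 := by
  rw [← sum_midDegree, ← sum_biUnion]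
  · exact sum_le_sum_of_subset (subset_univ _)
  · intro i _ j _ hij
    rw [Function.onFun, disjoint_left]
    intro x hx hx'
    simp only [mem_filter, mem_univ, true_and] at hx hx'
    rcases lt_or_gt_of_ne hij with hlt | hlt
    · exact absurd (hx.2.trans_le ((Nat.pow_le_pow_right hR hlt).trans hx'.1)) (lt_irrefl _)
    · exact absurd (hx'.2.trans_le ((Nat.pow_le_pow_right hR hlt).trans hx.1)) (lt_irrefl _)

end

/-- The numerical conditions on a degree window `[lo, lo * t)`. -/
theorem window_bounds {n e a lo s t u : ℕ} (hs : 0 < s) (ht : 0 < t) (he : e ≤ n * s)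
    (ha : a * (lo * t) ≤ 2 * e) (hst : 128 * (s * s) ≤ t) (hlo : lo * t * t ≤ n)
    (hu : 64 * (s * u) ≤ lo * t) (hun : 32 * u ≤ n) :
    16 * (2 * (a + 1) * (lo * e)) ≤ 2 * n ^ 2 ∧ 16 * (lo * t * e) ≤ n ^ 2 ∧
      16 * ((a + 1) * n * u) ≤ n ^ 2 := by
  have hst' : 128 * s ≤ t := by nlinarith
  have hlot : lo * t * e * 128 ≤ n ^ 2 := by
    calc lo * t * e * 128 ≤ lo * t * (n * s) * 128 := by gcongr
      _ = n * (lo * t * (128 * s)) := by ring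
      _ ≤ n * (lo * t * t) := by gcongr
      _ ≤ n * n := by gcongr
      _ = n ^ 2 := by ring
  have hloe : lo * e * 128 ≤ n ^ 2 := by
    refine le_trans ?_ hlot
    gcongr
    exact Nat.le_mul_of_pos_right _ ht
  have haloe : 64 * (a * lo * e) ≤ n ^ 2 := by
    refine Nat.le_of_mul_le_mul_right ?_ ht
    calc 64 * (a * lo * e) * t = 64 * (a * (lo * t) * e) := by ring
      _ ≤ 64 * (2 * e * e) := by gcongr
      _ ≤ 64 * (2 * (n * s) * (n * s)) := by gcongr
      _ = n ^ 2 * (128 * (s * s)) := by ring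
      _ ≤ n ^ 2 * t := by gcongr
  have hau : 32 * (a * u) ≤ n := by
    refine Nat.le_of_mul_le_mul_right ?_ (show 0 < 2 * s by omega)
    calc 32 * (a * u) * (2 * s) = a * (64 * (s * u)) := by ring
      _ ≤ a * (lo * t) := by gcongr
      _ ≤ 2 * e := ha
      _ ≤ 2 * (n * s) := by gcongr
      _ = n * (2 * s) := by ring
  refine ⟨?_, ?_, ?_⟩
  · linarith [Nat.zero_le (lo * e)]
  · linarith [Nat.zero_le (lo * t * e)]
  · calc 16 * ((a + 1) * n * u) = n * (16 * (a * u) + 16 * u) := by ring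
      _ ≤ n * n := by gcongr; omega
      _ = n ^ 2 := by ring

/-- The edge bound with logarithms replaced by integer exponents. -/
theorem IsDepthTwoSC.mul_sq_le {n m : ℕ} {E1 : Finset (Fin n × Fin m)}
    {E2 : Finset (Fin m × Fin n)} (h : IsDepthTwoSC n m E1 E2) (l r : ℕ)
    (hln : 2 ^ l ≤ n) (hlr : l < 2 ^ r) (hr : 2 ≤ r) (hrl : 100 * r ≤ l) :
    n * l ^ 2 ≤ 5120 * r * (E1.card + E2.card) := by
  set e := E1.card + E2.card with he
  have hn : 0 < n := lt_of_lt_of_le (by positivity) hln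
  by_cases hbig : n * l ^ 2 ≤ e
  · exact hbig.trans (Nat.le_mul_of_pos_left _ (by omega))
  have hl2 : l ^ 2 ≤ 2 ^ (2 * r) := by
    rw [mul_comm, pow_mul]
    exact Nat.pow_le_pow_left hlr.le 2
  have heR : e ≤ n * 2 ^ (2 * r) := (not_le.mp hbig).le.trans (Nat.mul_le_mul_left _ hl2)
  obtain ⟨q, hq⟩ : ∃ q, q = l / (40 * r) := ⟨_, rfl⟩
  obtain ⟨D, hD⟩ : ∃ D, D = l / 16 := ⟨_, rfl⟩
  have hr40 : 0 < 40 * r := by omega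
  have hq2 : 2 ≤ q := by
    rw [hq, Nat.le_div_iff_mul_le hr40]
    omega
  have hq_le : 40 * r * q ≤ l := hq ▸ Nat.mul_div_le l _
  have hq_lt : l < 40 * r * q + 40 * r := by
    have := Nat.lt_mul_div_succ l hr40
    rwa [← hq, mul_add, mul_one] at this
  have window : ∀ i ∈ Finset.Ico q (2 * q), (D + 1) * n <
      4 * ∑ x with (2 ^ (10 * r)) ^ i ≤ midDegree E1 E2 x ∧
        midDegree E1 E2 x < (2 ^ (10 * r)) ^ (i + 1), midDegree E1 E2 x := by
    intro i hi
    obtain ⟨hi1, hi2⟩ := Finset.mem_Ico.mp hi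
    have hi2' : 10 * r * (i + 1) ≤ 10 * r * (2 * q) := Nat.mul_le_mul_left _ hi2
    have hi1' : 10 * r * (q + 1) ≤ 10 * r * (i + 1) := by gcongr
    have hrq : r * 2 ≤ r * q := Nat.mul_le_mul_left r hq2
    have hR0 : 0 < (2 ^ (10 * r)) ^ (i + 1) := by positivity
    have hle2 : ∀ a b, a ≤ b → 2 ^ a ≤ 2 ^ b := fun a b => Nat.pow_le_pow_right two_pos
    obtain ⟨hlow, hmed, hkn⟩ := window_bounds (n := n) (e := e)
      (a := 2 * e / (2 ^ (10 * r)) ^ (i + 1)) (lo := (2 ^ (10 * r)) ^ i) (s := 2 ^ (2 * r))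
      (t := 2 ^ (10 * r)) (u := 4 ^ D) (by positivity) (by positivity) heR
      (by
        rw [← pow_succ]
        exact Nat.div_mul_le_self _ _)
      (by
        rw [show 128 = 2 ^ 7 by norm_num, ← pow_add, ← pow_add]
        exact hle2 _ _ (by omega))
      (by
        rw [← pow_succ, ← pow_mul, ← pow_add]
        refine (hle2 _ _ ?_).trans hln
        linarith)
      (by
        rw [show 64 = 2 ^ 6 by norm_num, show 4 = 2 ^ 2 by norm_num, ← pow_succ, ← pow_mul,
          ← pow_mul, ← pow_add, ← pow_add]
        refine hle2 _ _ ?_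
        have h1 : 16 * D ≤ l := hD ▸ Nat.mul_div_le l 16
        linarith)
      (by
        rw [show 32 = 2 ^ 5 by norm_num, show 4 = 2 ^ 2 by norm_num, ← pow_mul, ← pow_add]
        exact (hle2 _ _ (by omega)).trans hln)
    refine h.lt_sum_midDegree_window hn _ _ (2 * e / (2 ^ (10 * r)) ^ (i + 1) + 1) D
      (Nat.succ_pos _) hR0 ?_ hlow hmed hkn
    exact (Nat.lt_mul_div_succ (2 * e) hR0).le.trans_eq (mul_comm _ _)
  have hsum : q * ((D + 1) * n) ≤ 4 * e := by
    have h1 := Finset.sum_le_sum fun i hi => (window i hi).le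
    rw [Finset.sum_const, Nat.card_Ico, ← Finset.mul_sum, smul_eq_mul,
      show 2 * q - q = q by omega] at h1
    exact h1.trans (Nat.mul_le_mul_left 4 (sum_window_le _ q (2 * q) Nat.one_le_two_pow))
  have hD' : l ≤ 16 * (D + 1) := by omega
  have hq' : l ≤ 80 * r * q := by nlinarith
  calc n * l ^ 2 = n * (l * l) := by ring
    _ ≤ n * ((80 * r * q) * (16 * (D + 1))) := by gcongr
    _ = 1280 * r * (q * ((D + 1) * n)) := by ring
    _ ≤ 1280 * r * (4 * e) := by gcongr
    _ = 5120 * r * e := by ring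

/-- Radhakrishnan–Ta-Shma: there exists `c > 0` such that for all sufficiently large
`n`, every depth-two `n`-superconcentrator has at least
`c · n · (log n)² / log log n` edges. -/
theorem stmt_10 :
    ∃ c : ℝ, c > 0 ∧ ∃ N : ℕ, ∀ n : ℕ, N ≤ n →
      ∀ m : ℕ, ∀ E1 : Finset (Fin n × Fin m), ∀ E2 : Finset (Fin m × Fin n),
      IsDepthTwoSC n m E1 E2 →
        ((E1.card + E2.card : ℕ) : ℝ) ≥
          c * (n : ℝ) * (Real.log n) ^ 2 / Real.log (Real.log n) := by
  obtain ⟨N₁, hN₁⟩ : ∃ N₁ : ℕ, ∀ l : ℕ, N₁ ≤ l → 100 * (Nat.log 2 l + 1) ≤ l := by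
    have h : Filter.Tendsto (fun x : ℝ => Real.log x / x) Filter.atTop (nhds 0) :=
      Real.isLittleO_log_id_atTop.tendsto_div_nhds_zero
    have h' := (h.comp tendsto_natCast_atTop_atTop).eventually (gt_mem_nhds
      (show (0 : ℝ) < 1 / 400 by norm_num))
    obtain ⟨N, hN⟩ := Filter.eventually_atTop.mp h'
    refine ⟨max N 200, fun l hl => ?_⟩
    have hl200 : 200 ≤ l := (le_max_right _ _).trans hl
    have hl0 : (0 : ℝ) < l := by positivity
    have h1 : Real.log l / l < 1 / 400 := hN l ((le_max_left _ _).trans hl)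
    rw [div_lt_iff₀ hl0] at h1
    have h2 : ((2 ^ Nat.log 2 l : ℕ) : ℝ) ≤ l := by
      exact_mod_cast Nat.pow_log_le_self 2 (by omega)
    have h3 := Real.log_le_log (by positivity) h2
    push_cast at h3
    rw [Real.log_pow] at h3
    have h4 := Real.log_two_gt_d9
    have h5 : (200 : ℝ) ≤ l := by exact_mod_cast hl200
    have h6 : (0 : ℝ) ≤ Nat.log 2 l := Nat.cast_nonneg _
    have : (100 * (Nat.log 2 l + 1) : ℝ) ≤ l := by nlinarith
    exact_mod_cast this
  refine ⟨1 / 81920, by norm_num, 2 ^ (N₁ + 256), fun n hn m E1 E2 h => ?_⟩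
  set l := Nat.log 2 n with hl
  set r := Nat.log 2 l + 1 with hr
  have hn0 : n ≠ 0 := (lt_of_lt_of_le (by positivity) hn).ne'
  have hNl : N₁ + 256 ≤ l := Nat.le_log_of_pow_le one_lt_two hn
  have hr2 : 2 ≤ r := by
    have : 1 ≤ Nat.log 2 l := Nat.le_log_of_pow_le one_lt_two (by omega)
    omega
  have hle := h.mul_sq_le l r (Nat.pow_log_le_self 2 hn0)
    (Nat.lt_pow_succ_log_self one_lt_two l) hr2 (hN₁ l (by omega))
  have hle' : (n : ℝ) * (l : ℝ) ^ 2 ≤ 5120 * r * ((E1.card + E2.card : ℕ) : ℝ) := by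
    exact_mod_cast hle
  set e : ℝ := ((E1.card + E2.card : ℕ) : ℝ) with he
  have he0 : 0 ≤ e := Nat.cast_nonneg _
  set L := Real.log n with hL
  have hlog2 := Real.log_two_gt_d9
  have hlog2' := Real.log_two_lt_d9
  have hl256 : (256 : ℝ) ≤ l := by exact_mod_cast (by omega : 256 ≤ l)
  have hlL : (l : ℝ) * Real.log 2 ≤ L := by
    have h2 : ((2 ^ l : ℕ) : ℝ) ≤ n := by exact_mod_cast Nat.pow_log_le_self 2 hn0
    have h3 := Real.log_le_log (by positivity) h2
    push_cast at h3
    rwa [Real.log_pow] at h3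
  have hLl : L ≤ (l + 1) * Real.log 2 := by
    have h2 : (n : ℝ) ≤ ((2 ^ (l + 1) : ℕ) : ℝ) := by
      exact_mod_cast (Nat.lt_pow_succ_log_self one_lt_two n).le
    have h3 := Real.log_le_log (by positivity) h2
    push_cast at h3
    rw [Real.log_pow] at h3
    exact_mod_cast h3
  have hLle : L ≤ 2 * l := by nlinarith
  have hL128 : (128 : ℝ) ≤ L := by nlinarith
  have hLL : 7 * Real.log 2 ≤ Real.log L := by
    have h3 := Real.log_le_log (by norm_num) hL128
    rwa [show (128 : ℝ) = 2 ^ 7 by norm_num, Real.log_pow, Nat.cast_ofNat] at h3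
  have hrLL : (r : ℝ) ≤ 4 * Real.log L := by
    have h2 : ((2 ^ Nat.log 2 l : ℕ) : ℝ) ≤ 2 * L := by
      have : ((2 ^ Nat.log 2 l : ℕ) : ℝ) ≤ l := by
        exact_mod_cast Nat.pow_log_le_self 2 (by omega)
      nlinarith
    have h3 := Real.log_le_log (by positivity) h2
    rw [Real.log_mul (by norm_num) (by positivity)] at h3
    push_cast at h3
    rw [Real.log_pow] at h3
    have h6 : (0 : ℝ) ≤ Nat.log 2 l := Nat.cast_nonneg _
    rw [hr]
    push_cast
    nlinarith
  have hLL0 : 0 < Real.log L := by linarith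
  rw [ge_iff_le, div_le_iff₀ hLL0]
  have h1 : L ^ 2 ≤ 4 * (l : ℝ) ^ 2 := by nlinarith
  have h2 : (n : ℝ) * L ^ 2 ≤ n * (4 * (l : ℝ) ^ 2) := by gcongr
  have h3 : (r : ℝ) * e ≤ 4 * Real.log L * e := by gcongr
  linarith
end

section
/- There exists a constant c > 0 such that the following holds for all sufficiently large n: if G = (V, M, W, E) is a depth-two n-superconcentrator in which the average degree of the vertices in V is a (i.e., the number of edges from V to M equals a·n) and the average degree of the vertices in W is b (i.e., the number of edges from M to W equals b·n), and a ≤ b, then a · log((a + b)/a) · log b ≥ c · (log n)². -/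
open Finset in
/-- In a random subset of `ι` containing each element independently with probability `q`,
the probability of containing `N` and avoiding `N'`. -/
lemma sum_bernoulli_eq {ι : Type*} [Fintype ι] [DecidableEq ι] {q r : ℝ} (hqr : q + r = 1)
    (N N' : Finset ι) (h : Disjoint N N') :
    ∑ A : Finset ι, q ^ #A * r ^ #Aᶜ * (if N ⊆ A ∧ Disjoint N' A then 1 else 0) =
      q ^ #N * r ^ #N' := by
  have key := Finset.prod_add (fun i => if i ∈ N' then 0 else q)
    (fun i => if i ∈ N then 0 else r) (univ : Finset ι)
  rw [powerset_univ] at key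
  have hl : ∏ i : ι, ((if i ∈ N' then 0 else q) + (if i ∈ N then 0 else r)) =
      q ^ #N * r ^ #N' := by
    have h1 : ∀ i : ι, ((if i ∈ N' then 0 else q) + (if i ∈ N then 0 else r)) =
        (if i ∈ N then q else 1) * (if i ∈ N' then r else 1) := by
      intro i
      by_cases hi : i ∈ N
      · have : i ∉ N' := Finset.disjoint_left.mp h hi
        simp [hi, this]
      · by_cases hi' : i ∈ N' <;> simp [hi, hi', hqr]
    simp_rw [h1, prod_mul_distrib]
    simp
  rw [← hl, key]
  refine sum_congr rfl fun A _ => ?_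
  rw [← compl_eq_univ_sdiff]
  split_ifs with hA
  · rw [prod_congr rfl (g := fun _ => q), prod_congr (s₁ := Aᶜ) rfl (g := fun _ => r)]
    · simp
    · intro i hi
      rw [if_neg]
      exact fun hN => (mem_compl.mp hi) (hA.1 hN)
    · intro i hi
      rw [if_neg]
      exact fun hN => Finset.disjoint_left.mp hA.2 hN hi
  · rw [mul_zero, eq_comm, mul_eq_zero]
    rw [not_and_or, not_subset, Finset.not_disjoint_iff] at hA
    rcases hA with ⟨i, hi, hiA⟩ | ⟨i, hi, hiA⟩
    · exact Or.inr (prod_eq_zero (mem_compl.mpr hiA) (if_pos hi))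
    · exact Or.inl (prod_eq_zero hiA (if_pos hi))

open Finset in
/-- A variance bound for a sum of mean-one variables, most pairs of which are uncorrelated. -/
lemma second_moment_le {Ω α : Type*} [Fintype Ω] {μ : Ω → ℝ} (hμ0 : ∀ ω, 0 ≤ μ ω)
    (hμ1 : ∑ ω, μ ω = 1) (V : Finset α) {x : α → Ω → ℝ} {P s : ℝ} (hx0 : ∀ v ω, 0 ≤ x v ω)
    (hP : 0 ≤ P) (hxP : ∀ v ∈ V, ∀ ω, x v ω ≤ P) (hE : ∀ v ∈ V, ∑ ω, μ ω * x v ω = 1)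
    (rel : α → α → Prop) [DecidableRel rel]
    (hrel : ∀ v ∈ V, ∀ v' ∈ V, ¬ rel v v' → ∑ ω, μ ω * (x v ω * x v' ω) ≤ 1)
    (hs : ∀ v ∈ V, (#{v' ∈ V | rel v v'} : ℝ) ≤ s) :
    ∑ ω, μ ω * (∑ v ∈ V, x v ω - #V) ^ 2 ≤ #V * (s * P) := by
  have h1 : ∀ v ∈ V, ∀ v' ∈ V, ∑ ω, μ ω * (x v ω * x v' ω) ≤ 1 + if rel v v' then P else 0 := by
    intro v hv v' hv'
    split_ifs with h
    · calc ∑ ω, μ ω * (x v ω * x v' ω) ≤ ∑ ω, P * (μ ω * x v' ω) := by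
            refine sum_le_sum fun ω _ => ?_
            have := mul_le_mul_of_nonneg_right (hxP v hv ω) (mul_nonneg (hμ0 ω) (hx0 v' ω))
            linarith
        _ = P := by rw [← mul_sum, hE v' hv', mul_one]
        _ ≤ 1 + P := by linarith
    · simpa using hrel v hv v' hv' h
  have h2 : ∑ ω, μ ω * (∑ v ∈ V, x v ω) ^ 2 ≤ (#V : ℝ) ^ 2 + #V * (s * P) := by
    calc ∑ ω, μ ω * (∑ v ∈ V, x v ω) ^ 2
        = ∑ v ∈ V, ∑ v' ∈ V, ∑ ω, μ ω * (x v ω * x v' ω) := by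
          simp_rw [sq, sum_mul_sum, mul_sum]
          rw [sum_comm]
          refine sum_congr rfl fun v _ => ?_
          rw [sum_comm]
      _ ≤ ∑ v ∈ V, ∑ v' ∈ V, (1 + if rel v v' then P else 0) :=
          sum_le_sum fun v hv => sum_le_sum fun v' hv' => h1 v hv v' hv'
      _ ≤ ∑ v ∈ V, (#V + s * P) := by
          refine sum_le_sum fun v hv => ?_
          rw [sum_add_distrib, ← sum_filter]
          simp only [sum_const, nsmul_eq_mul, mul_one]
          have := mul_le_mul_of_nonneg_right (hs v hv) hP
          linarith
      _ = _ := by simp only [sum_const, nsmul_eq_mul]; ring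
  have h3 : ∑ ω, μ ω * ∑ v ∈ V, x v ω = #V := by
    simp_rw [mul_sum]
    rw [sum_comm, sum_congr rfl hE]
    simp
  have h4 : ∑ ω, μ ω * (∑ v ∈ V, x v ω - #V) ^ 2 = ∑ ω, μ ω * (∑ v ∈ V, x v ω) ^ 2
      - 2 * #V * ∑ ω, μ ω * ∑ v ∈ V, x v ω + #V ^ 2 * ∑ ω, μ ω := by
    rw [mul_sum, mul_sum, ← sum_sub_distrib, ← sum_add_distrib]
    exact sum_congr rfl fun ω _ => by ring
  rw [h4, h3, hμ1]
  linarith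

open Finset in
/-- Some outcome makes two random sums large while keeping a sum of products small. -/
lemma exists_outcome {Ω α β : Type*} [Fintype Ω] {μ : Ω → ℝ} (hμ0 : ∀ ω, 0 ≤ μ ω)
    (hμ1 : ∑ ω, μ ω = 1) (V : Finset α) (W : Finset β) {x : α → Ω → ℝ} {y : β → Ω → ℝ}
    (hx0 : ∀ v ω, 0 ≤ x v ω) (hy0 : ∀ v ω, 0 ≤ y v ω) (L : Finset (α × β)) {c d l : ℝ}
    (hV : 0 < #V) (hW : 0 < #W) (hl : 0 < l)
    (hX : ∑ ω, μ ω * (∑ v ∈ V, x v ω - #V) ^ 2 ≤ #V * c) (hc : 32 * c ≤ #V)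
    (hY : ∑ ω, μ ω * (∑ w ∈ W, y w ω - #W) ^ 2 ≤ #W * d) (hd : 32 * d ≤ #W)
    (hL : (#L : ℝ) ≤ l) (hxy : ∀ e ∈ L, ∑ ω, μ ω * (x e.1 ω * y e.2 ω) ≤ 1) :
    ∃ ω, (#V : ℝ) / 2 ≤ ∑ v ∈ V, x v ω ∧ (#W : ℝ) / 2 ≤ ∑ w ∈ W, y w ω ∧
      ∑ e ∈ L, x e.1 ω * y e.2 ω ≤ 2 * l := by
  have hV' : (0 : ℝ) < #V := by exact_mod_cast hV
  have hW' : (0 : ℝ) < #W := by exact_mod_cast hW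
  set f : Ω → ℝ := fun ω => 4 / (#V : ℝ) ^ 2 * (∑ v ∈ V, x v ω - #V) ^ 2 +
    4 / (#W : ℝ) ^ 2 * (∑ w ∈ W, y w ω - #W) ^ 2 + 1 / (2 * l) * ∑ e ∈ L, x e.1 ω * y e.2 ω
    with hf
  have hEf : ∑ ω, μ ω * f ω < 1 := by
    have e1 : ∑ ω, μ ω * f ω = 4 / (#V : ℝ) ^ 2 * ∑ ω, μ ω * (∑ v ∈ V, x v ω - #V) ^ 2 +
        4 / (#W : ℝ) ^ 2 * ∑ ω, μ ω * (∑ w ∈ W, y w ω - #W) ^ 2 +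
        1 / (2 * l) * ∑ ω, μ ω * ∑ e ∈ L, x e.1 ω * y e.2 ω := by
      simp only [hf]
      rw [mul_sum, mul_sum, mul_sum, ← sum_add_distrib, ← sum_add_distrib]
      exact sum_congr rfl fun ω _ => by ring
    have e2 : ∑ ω, μ ω * ∑ e ∈ L, x e.1 ω * y e.2 ω ≤ l := by
      simp_rw [mul_sum]
      rw [sum_comm]
      calc _ ≤ ∑ e ∈ L, (1 : ℝ) := sum_le_sum hxy
        _ ≤ l := by simpa using hL
    have e3 : 4 / (#V : ℝ) ^ 2 * ∑ ω, μ ω * (∑ v ∈ V, x v ω - #V) ^ 2 ≤ 1 / 8 := by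
      rw [div_mul_eq_mul_div, div_le_iff₀ (by positivity)]
      nlinarith
    have e4 : 4 / (#W : ℝ) ^ 2 * ∑ ω, μ ω * (∑ w ∈ W, y w ω - #W) ^ 2 ≤ 1 / 8 := by
      rw [div_mul_eq_mul_div, div_le_iff₀ (by positivity)]
      nlinarith
    have e5 : 1 / (2 * l) * ∑ ω, μ ω * ∑ e ∈ L, x e.1 ω * y e.2 ω ≤ 1 / 2 := by
      rw [div_mul_eq_mul_div, div_le_iff₀ (by positivity)]
      linarith
    rw [e1]
    linarith
  obtain ⟨ω, hω⟩ : ∃ ω, f ω < 1 := by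
    by_contra! hcon
    have : ∑ ω, μ ω * 1 ≤ ∑ ω, μ ω * f ω :=
      sum_le_sum fun ω _ => mul_le_mul_of_nonneg_left (hcon ω) (hμ0 ω)
    simp only [mul_one] at this
    linarith
  have hs : 0 ≤ ∑ e ∈ L, x e.1 ω * y e.2 ω :=
    sum_nonneg fun e _ => mul_nonneg (hx0 _ _) (hy0 _ _)
  have t1 : 0 ≤ 4 / (#V : ℝ) ^ 2 * (∑ v ∈ V, x v ω - #V) ^ 2 := by positivity
  have t2 : 0 ≤ 4 / (#W : ℝ) ^ 2 * (∑ w ∈ W, y w ω - #W) ^ 2 := by positivity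
  have t3 : 0 ≤ 1 / (2 * l) * ∑ e ∈ L, x e.1 ω * y e.2 ω := by positivity
  simp only [hf] at hω
  refine ⟨ω, ?_, ?_, ?_⟩
  · have h : 4 / (#V : ℝ) ^ 2 * (∑ v ∈ V, x v ω - #V) ^ 2 < 1 := by linarith
    rw [div_mul_eq_mul_div, div_lt_one (by positivity)] at h
    by_contra! hcon
    nlinarith
  · have h : 4 / (#W : ℝ) ^ 2 * (∑ w ∈ W, y w ω - #W) ^ 2 < 1 := by linarith
    rw [div_mul_eq_mul_div, div_lt_one (by positivity)] at h
    by_contra! hcon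
    nlinarith
  · have h : 1 / (2 * l) * ∑ e ∈ L, x e.1 ω * y e.2 ω < 1 := by linarith
    rw [div_mul_eq_mul_div, div_lt_one (by positivity)] at h
    linarith

open Finset in
/-- A set of large total weight with small individual weights has `k` elements of nonzero weight
outside any set of small weight. -/
lemma exists_subset_card_of_weight {α : Type*} (V : Finset α) (x : α → ℝ)
    (bad : α → Prop) [DecidablePred bad] {P w : ℝ} {k : ℕ} (hP : 0 < P)
    (hxP : ∀ v ∈ V, x v ≤ P) (hV : 2 * w ≤ ∑ v ∈ V, x v)
    (hbad : ∑ v ∈ V with bad v, x v ≤ w) (hk : k * P ≤ w) :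
    ∃ S ⊆ V, #S = k ∧ ∀ v ∈ S, x v ≠ 0 ∧ ¬ bad v := by
  classical
  have h1 : w ≤ ∑ v ∈ V with ¬ bad v, x v := by
    have := sum_filter_add_sum_filter_not V bad x
    linarith
  have h2 : w ≤ ∑ v ∈ V with ¬ bad v ∧ x v ≠ 0, x v := by
    rw [← filter_filter, sum_filter_ne_zero]
    exact h1
  have h3 : ∑ v ∈ V with ¬ bad v ∧ x v ≠ 0, x v ≤ #{v ∈ V | ¬ bad v ∧ x v ≠ 0} * P := by
    rw [← nsmul_eq_mul]
    exact sum_le_card_nsmul _ _ _ fun v hv => hxP v (mem_filter.mp hv).1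
  have h4 : k ≤ #{v ∈ V | ¬ bad v ∧ x v ≠ 0} := by
    have : (k : ℝ) * P ≤ #{v ∈ V | ¬ bad v ∧ x v ≠ 0} * P := by linarith
    exact_mod_cast le_of_mul_le_mul_right this hP
  obtain ⟨S, hS, hSk⟩ := exists_subset_card_eq h4
  refine ⟨S, hS.trans (filter_subset _ _), hSk, fun v hv => ?_⟩
  have := (mem_filter.mp (hS hv)).2
  exact ⟨this.2, this.1⟩

open Finset in
/-- Weighted extraction of a pair of `k`-sets with no related pair between them. -/
lemma exists_bi_independent {α β : Type*} (V : Finset α) (W : Finset β) (x : α → ℝ) (y : β → ℝ)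
    (low : α → β → Prop) {P n : ℝ} {k : ℕ} (hn : 0 < n) (hk0 : 0 < k) (hP : 0 < P)
    (hx0 : ∀ v, 0 ≤ x v) (hy0 : ∀ w, 0 ≤ y w)
    (hxP : ∀ v ∈ V, x v ≤ P) (hyP : ∀ w ∈ W, y w ≤ P)
    (hV : n / 4 ≤ ∑ v ∈ V, x v) (hW : n / 4 ≤ ∑ w ∈ W, y w) (L : Finset (α × β))
    (hLm : ∀ v ∈ V, ∀ w ∈ W, low v w → (v, w) ∈ L)
    (hL : ∑ e ∈ L, x e.1 * y e.2 ≤ n ^ 2 / (64 * k)) (hk : 8 * k * P ≤ n) :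
    ∃ S ⊆ V, ∃ T ⊆ W, #S = k ∧ #T = k ∧ (∀ v ∈ S, x v ≠ 0) ∧ (∀ w ∈ T, y w ≠ 0) ∧
      ∀ v ∈ S, ∀ w ∈ T, ¬ low v w := by
  classical
  have hk' : (0 : ℝ) < k := by exact_mod_cast hk0
  set D : α → ℝ := fun v => ∑ w ∈ W with low v w, y w with hD
  have hD0 : ∀ v, 0 ≤ D v := fun v => sum_nonneg fun w _ => hy0 w
  have hxD : ∑ v ∈ V, x v * D v ≤ n ^ 2 / (64 * k) := by
    refine le_trans ?_ hL
    calc ∑ v ∈ V, x v * D v = ∑ e ∈ V ×ˢ W with low e.1 e.2, x e.1 * y e.2 := by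
          simp only [hD, mul_sum, sum_filter, sum_product, mul_ite, mul_zero]
      _ ≤ _ := by
          refine sum_le_sum_of_subset_of_nonneg ?_ fun e _ _ => mul_nonneg (hx0 _) (hy0 _)
          intro e he
          rw [mem_filter, mem_product] at he
          exact hLm _ he.1.1 _ he.1.2 he.2
  obtain ⟨S, hSV, hSk, hS⟩ := exists_subset_card_of_weight V x (fun v => n / (8 * k) < D v)
    (P := P) (w := n / 8) (k := k) hP hxP (by linarith) (by
      have h1 : ∑ v ∈ V with n / (8 * k) < D v, x v * (n / (8 * k)) ≤ n ^ 2 / (64 * k) := by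
        refine le_trans ?_ hxD
        refine le_trans (sum_le_sum fun v hv => mul_le_mul_of_nonneg_left
          (mem_filter.mp hv).2.le (hx0 v)) ?_
        exact sum_le_sum_of_subset_of_nonneg (filter_subset _ _)
          fun v _ _ => mul_nonneg (hx0 v) (hD0 v)
      rw [← sum_mul] at h1
      have h2 : n ^ 2 / (64 * k) = n / 8 * (n / (8 * k)) := by field_simp; norm_num
      rw [h2] at h1
      exact le_of_mul_le_mul_right h1 (by positivity)) (by linarith)
  obtain ⟨T, hTW, hTk, hT⟩ := exists_subset_card_of_weight W y (fun w => ∃ v ∈ S, low v w)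
    (P := P) (w := n / 8) (k := k) hP hyP (by linarith) (by
      calc ∑ w ∈ W with ∃ v ∈ S, low v w, y w
          ≤ ∑ w ∈ W, ∑ v ∈ S, if low v w then y w else 0 := by
            rw [sum_filter]
            refine sum_le_sum fun w _ => ?_
            have hnn : ∀ v ∈ S, 0 ≤ if low v w then y w else 0 := fun v _ => by
              split_ifs
              exacts [hy0 w, le_rfl]
            split_ifs with h
            · obtain ⟨v, hv, hl⟩ := h
              simpa [hl] using single_le_sum hnn hv
            · exact sum_nonneg hnn
        _ = ∑ v ∈ S, D v := by
            rw [sum_comm]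
            simp only [hD, sum_filter]
        _ ≤ ∑ v ∈ S, n / (8 * k) := sum_le_sum fun v hv => not_lt.mp (hS v hv).2
        _ = n / 8 := by rw [sum_const, hSk, nsmul_eq_mul]; field_simp) (by linarith)
  exact ⟨S, hSV, T, hTW, hSk, hTk, fun v hv => (hS v hv).1, fun w hw => (hT w hw).1,
    fun v hv w hw hl => (hT w hw).2 ⟨v, hv, hl⟩⟩

open Finset in
/-- Among the vertices on one side of a bipartite graph, at least half have degree at most twice
the average, and such a vertex shares neighbours with few others. -/
lemma exists_half_degree_le {α ι : Type*} [Fintype α] [DecidableEq α] [DecidableEq ι]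
    (M : Finset ι) (e : α → ι → Prop) [∀ v, DecidablePred (e v)] {c D : ℝ} (hc : 0 < c)
    (hD0 : 0 ≤ D) (hsum : ∑ j ∈ M, (#{v | e v j} : ℝ) ≤ c * Fintype.card α)
    (hD : ∀ j ∈ M, (#{v | e v j} : ℝ) ≤ D) :
    ∃ V : Finset α, (Fintype.card α : ℝ) / 2 ≤ #V ∧ ∀ v ∈ V, (#{j ∈ M | e v j} : ℝ) ≤ 2 * c ∧
      (#{v' ∈ V | ¬ Disjoint {j ∈ M | e v j} {j ∈ M | e v' j}} : ℝ) ≤ 2 * c * D := by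
  classical
  have hswap : ∑ v : α, (#{j ∈ M | e v j} : ℝ) = ∑ j ∈ M, (#{v | e v j} : ℝ) := by
    have := sum_card_bipartiteAbove_eq_sum_card_bipartiteBelow (s := (univ : Finset α)) (t := M) e
    unfold bipartiteAbove bipartiteBelow at this
    exact_mod_cast this
  refine ⟨({v | (#{j ∈ M | e v j} : ℝ) ≤ 2 * c} : Finset α), ?_, fun v hv => ?_⟩
  · have h1 : (#{v : α | ¬ (#{j ∈ M | e v j} : ℝ) ≤ 2 * c} : ℝ) * (2 * c) ≤
        c * Fintype.card α := by
      rw [← hswap] at hsum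
      refine le_trans ?_ hsum
      rw [← nsmul_eq_mul]
      refine (card_nsmul_le_sum _ (fun v => (#{j ∈ M | e v j} : ℝ)) _ fun v hv => ?_).trans
        (sum_le_sum_of_subset_of_nonneg (subset_univ _) fun _ _ _ => by positivity)
      exact (not_le.mp (mem_filter.mp hv).2).le
    have h2 : (#{v : α | (#{j ∈ M | e v j} : ℝ) ≤ 2 * c} : ℝ) +
        #{v : α | ¬ (#{j ∈ M | e v j} : ℝ) ≤ 2 * c} = Fintype.card α := by
      have := card_filter_add_card_filter_not (s := (univ : Finset α))
        (fun v => (#{j ∈ M | e v j} : ℝ) ≤ 2 * c)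
      rw [card_univ] at this
      exact_mod_cast this
    have h3 : (#{v : α | ¬ (#{j ∈ M | e v j} : ℝ) ≤ 2 * c} : ℝ) ≤ Fintype.card α / 2 := by
      refine le_of_mul_le_mul_right ?_ hc
      linarith
    linarith
  · have hv' := (mem_filter.mp hv).2
    refine ⟨hv', ?_⟩
    have hsub : ({v' ∈ ({v | (#{j ∈ M | e v j} : ℝ) ≤ 2 * c} : Finset α) |
        ¬ Disjoint {j ∈ M | e v j} {j ∈ M | e v' j}}) ⊆
        ({j ∈ M | e v j} : Finset ι).biUnion fun j => ({v' | e v' j} : Finset α) := by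
      intro v' h
      obtain ⟨j, hj, hj'⟩ := Finset.not_disjoint_iff.mp (mem_filter.mp h).2
      exact mem_biUnion.mpr ⟨j, hj, by simpa using (mem_filter.mp hj').2⟩
    calc (_ : ℝ) ≤ ((∑ j ∈ M with e v j, #{v' : α | e v' j} : ℕ) : ℝ) :=
          by exact_mod_cast (card_le_card hsub).trans card_biUnion_le
      _ ≤ ∑ j ∈ M with e v j, D := by
          push_cast
          exact sum_le_sum fun j hj => hD j (mem_filter.mp hj).1
      _ = #{j ∈ M | e v j} * D := by rw [sum_const, nsmul_eq_mul]
      _ ≤ _ := mul_le_mul_of_nonneg_right hv' hD0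

lemma inv_pow_le_of_rpow_le {q c P : ℝ} {d : ℕ} (hq : 0 < q) (hq1 : q ≤ 1) (hd : (d : ℝ) ≤ c)
    (hP : q⁻¹ ^ c ≤ P) : (q ^ d)⁻¹ ≤ P := by
  rw [← inv_pow, ← Real.rpow_natCast]
  exact (Real.rpow_le_rpow_of_exponent_le (one_le_inv_iff₀.mpr ⟨hq, hq1⟩) hd).trans hP

open Finset in
/-- If the middle vertices in `M` have bounded degrees and carry few edges, then after deleting
one side of the neighbourhood of each of them there remain two `k`-sets spanning no `low` pair. -/
lemma exists_separated_sets {α β ι : Type*} [Fintype α] [Fintype β] [Fintype ι]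
    [DecidableEq α] [DecidableEq β] [DecidableEq ι]
    (M : Finset ι) (e : α → ι → Prop) (f : β → ι → Prop) [∀ v, DecidablePred (e v)]
    [∀ w, DecidablePred (f w)] (low : α → β → Prop) [∀ v, DecidablePred (low v)]
    {q r c d D D' P : ℝ} {n k : ℕ}
    (hα : Fintype.card α = n) (hβ : Fintype.card β = n) (hn : 0 < n) (hk : 0 < k)
    (hq : 0 < q) (hr : 0 < r) (hqr : q + r = 1) (hc : 0 < c) (hd : 0 < d) (hD0 : 0 ≤ D)
    (hD0' : 0 ≤ D')
    (hsum : ∑ j ∈ M, (#{v | e v j} : ℝ) ≤ c * n) (hsum' : ∑ j ∈ M, (#{w | f w j} : ℝ) ≤ d * n)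
    (hD : ∀ j ∈ M, (#{v | e v j} : ℝ) ≤ D) (hD' : ∀ j ∈ M, (#{w | f w j} : ℝ) ≤ D')
    (hP : q⁻¹ ^ (2 * c) ≤ P) (hP' : r⁻¹ ^ (2 * d) ≤ P)
    (hDn : 128 * c * D * P ≤ n) (hDn' : 128 * d * D' * P ≤ n)
    (hlow : (#{p : α × β | low p.1 p.2} : ℝ) ≤ n ^ 2 / (128 * k)) (hkn : 8 * k * P ≤ n) :
    ∃ (S : Finset α) (T : Finset β) (A : Finset ι), #S = k ∧ #T = k ∧
      (∀ v ∈ S, ∀ j ∈ M, e v j → j ∈ A) ∧ (∀ w ∈ T, ∀ j ∈ M, f w j → j ∉ A) ∧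
      ∀ v ∈ S, ∀ w ∈ T, ¬ low v w := by
  have hn' : (0 : ℝ) < n := by exact_mod_cast hn
  have hk' : (0 : ℝ) < k := by exact_mod_cast hk
  have hP0 : 0 < P := lt_of_lt_of_le (by positivity) hP
  obtain ⟨V, hV, hVd⟩ := exists_half_degree_le M e hc hD0 (by rwa [hα]) hD
  obtain ⟨W, hW, hWd⟩ := exists_half_degree_le M f hd hD0' (by rwa [hβ]) hD'
  rw [hα] at hV
  rw [hβ] at hW
  set N : α → Finset ι := fun v => {j ∈ M | e v j} with hN
  set N' : β → Finset ι := fun w => {j ∈ M | f w j} with hN'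
  set μ : Finset ι → ℝ := fun A => q ^ #A * r ^ #Aᶜ with hμ
  set x : α → Finset ι → ℝ := fun v A => if N v ⊆ A then (q ^ #(N v))⁻¹ else 0 with hx
  set y : β → Finset ι → ℝ := fun w A => if Disjoint (N' w) A then (r ^ #(N' w))⁻¹ else 0 with hy
  have hμ0 : ∀ A, 0 ≤ μ A := fun A => by positivity
  have hx0 : ∀ v A, 0 ≤ x v A := fun v A => by
    simp only [hx]
    positivity
  have hy0 : ∀ w A, 0 ≤ y w A := fun w A => by
    simp only [hy]
    positivity
  have hμ1 : ∑ A, μ A = 1 := by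
    simpa [hμ] using sum_bernoulli_eq hqr (∅ : Finset ι) ∅ (disjoint_empty_left _)
  have hxP : ∀ v ∈ V, ∀ A, x v A ≤ P := fun v hv A => by
    simp only [hx]
    split_ifs
    · exact inv_pow_le_of_rpow_le hq (by linarith) (hVd v hv).1 hP
    · exact hP0.le
  have hyP : ∀ w ∈ W, ∀ A, y w A ≤ P := fun w hw A => by
    simp only [hy]
    split_ifs
    · exact inv_pow_le_of_rpow_le hr (by linarith) (hWd w hw).1 hP'
    · exact hP0.le
  have hxE : ∀ v, ∑ A, μ A * x v A = 1 := fun v => by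
    have h := sum_bernoulli_eq hqr (N v) ∅ (disjoint_empty_right _)
    have h0 : q ^ #(N v) ≠ 0 := by positivity
    simp only [disjoint_empty_left, and_true, card_empty, pow_zero, mul_one] at h
    calc ∑ A, μ A * x v A = (∑ A, μ A * if N v ⊆ A then 1 else 0) * (q ^ #(N v))⁻¹ := by
          rw [sum_mul]
          refine sum_congr rfl fun A _ => ?_
          simp only [hx]
          split_ifs <;> ring
      _ = 1 := by rw [h, mul_inv_cancel₀ h0]
  have hyE : ∀ w, ∑ A, μ A * y w A = 1 := fun w => by
    have h := sum_bernoulli_eq hqr ∅ (N' w) (disjoint_empty_left _)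
    have h0 : r ^ #(N' w) ≠ 0 := by positivity
    simp only [empty_subset, true_and, card_empty, pow_zero, one_mul] at h
    calc ∑ A, μ A * y w A = (∑ A, μ A * if Disjoint (N' w) A then 1 else 0) * (r ^ #(N' w))⁻¹ := by
          rw [sum_mul]
          refine sum_congr rfl fun A _ => ?_
          simp only [hy]
          split_ifs <;> ring
      _ = 1 := by rw [h, mul_inv_cancel₀ h0]
  have hxx : ∀ v ∈ V, ∀ v' ∈ V, ¬ ¬ Disjoint (N v) (N v') →
      ∑ A, μ A * (x v A * x v' A) ≤ 1 := by
    intro v _ v' _ hdis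
    rw [not_not] at hdis
    have h := sum_bernoulli_eq hqr (N v ∪ N v') ∅ (disjoint_empty_right _)
    have h0 : q ^ #(N v) ≠ 0 := by positivity
    have h0' : q ^ #(N v') ≠ 0 := by positivity
    simp only [disjoint_empty_left, and_true, card_empty, pow_zero, mul_one, union_subset_iff,
      card_union_of_disjoint hdis, pow_add] at h
    refine le_of_eq ?_
    calc ∑ A, μ A * (x v A * x v' A) = (∑ A, μ A * if N v ⊆ A ∧ N v' ⊆ A then 1 else 0) *
          ((q ^ #(N v))⁻¹ * (q ^ #(N v'))⁻¹) := by
          rw [sum_mul]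
          refine sum_congr rfl fun A _ => ?_
          simp only [hx]
          by_cases h1 : N v ⊆ A <;> by_cases h2 : N v' ⊆ A <;> simp [h1, h2]
      _ = 1 := by rw [h]; field_simp
  have hyy : ∀ w ∈ W, ∀ w' ∈ W, ¬ ¬ Disjoint (N' w) (N' w') →
      ∑ A, μ A * (y w A * y w' A) ≤ 1 := by
    intro w _ w' _ hdis
    rw [not_not] at hdis
    have h := sum_bernoulli_eq hqr ∅ (N' w ∪ N' w') (disjoint_empty_left _)
    have h0 : r ^ #(N' w) ≠ 0 := by positivity
    have h0' : r ^ #(N' w') ≠ 0 := by positivity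
    simp only [empty_subset, true_and, card_empty, pow_zero, one_mul, disjoint_union_left,
      card_union_of_disjoint hdis, pow_add] at h
    refine le_of_eq ?_
    calc ∑ A, μ A * (y w A * y w' A) =
          (∑ A, μ A * if Disjoint (N' w) A ∧ Disjoint (N' w') A then 1 else 0) *
          ((r ^ #(N' w))⁻¹ * (r ^ #(N' w'))⁻¹) := by
          rw [sum_mul]
          refine sum_congr rfl fun A _ => ?_
          simp only [hy]
          by_cases h1 : Disjoint (N' w) A <;> by_cases h2 : Disjoint (N' w') A <;> simp [h1, h2]
      _ = 1 := by rw [h]; field_simp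
  have hxy : ∀ v w, ∑ A, μ A * (x v A * y w A) ≤ 1 := by
    intro v w
    by_cases hdis : Disjoint (N v) (N' w)
    · have h := sum_bernoulli_eq hqr (N v) (N' w) hdis
      have h0 : q ^ #(N v) ≠ 0 := by positivity
      have h0' : r ^ #(N' w) ≠ 0 := by positivity
      refine le_of_eq ?_
      calc ∑ A, μ A * (x v A * y w A) =
            (∑ A, μ A * if N v ⊆ A ∧ Disjoint (N' w) A then 1 else 0) *
            ((q ^ #(N v))⁻¹ * (r ^ #(N' w))⁻¹) := by
            rw [sum_mul]
            refine sum_congr rfl fun A _ => ?_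
            simp only [hx, hy]
            by_cases h1 : N v ⊆ A <;> by_cases h2 : Disjoint (N' w) A <;> simp [h1, h2]
        _ = 1 := by rw [h]; field_simp
    · obtain ⟨j, hj, hj'⟩ := Finset.not_disjoint_iff.mp hdis
      refine le_trans (le_of_eq (sum_eq_zero fun A _ => ?_)) zero_le_one
      simp only [hx, hy]
      by_cases h1 : N v ⊆ A
      · rw [if_neg (c := Disjoint (N' w) A) fun h2 => Finset.disjoint_left.mp h2 hj' (h1 hj)]
        simp
      · simp [h1]
  have hX := second_moment_le hμ0 hμ1 V hx0 hP0.le hxP (fun v _ => hxE v)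
    (fun v v' => ¬ Disjoint (N v) (N v')) hxx fun v hv => (hVd v hv).2
  have hY := second_moment_le hμ0 hμ1 W hy0 hP0.le hyP (fun v _ => hyE v)
    (fun v v' => ¬ Disjoint (N' v) (N' v')) hyy fun v hv => (hWd v hv).2
  have hV0 : (0 : ℝ) < #V := by linarith
  have hW0 : (0 : ℝ) < #W := by linarith
  obtain ⟨A, hA1, hA2, hA3⟩ := exists_outcome hμ0 hμ1 V W hx0 hy0
    ({p : α × β | low p.1 p.2} : Finset (α × β)) (l := n ^ 2 / (128 * k))
    (by exact_mod_cast hV0) (by exact_mod_cast hW0) (by positivity) hX (by nlinarith) hY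
    (by nlinarith) hlow fun p _ => hxy p.1 p.2
  obtain ⟨S, hSV, T, hTW, hS, hT, hSx, hTy, hST⟩ := exists_bi_independent V W (fun v => x v A)
    (fun w => y w A) low (n := n) (k := k) hn' hk hP0 (fun v => hx0 v A) (fun w => hy0 w A)
    (fun v hv => hxP v hv A) (fun w hw => hyP w hw A) (by linarith) (by linarith)
    ({p : α × β | low p.1 p.2} : Finset (α × β)) (fun v _ w _ h => by simpa using h)
    (hA3.trans (le_of_eq (by field_simp; norm_num))) hkn
  refine ⟨S, T, A, hS, hT, fun v hv j hj he => ?_, fun w hw j hj hf => ?_, hST⟩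
  · have h : N v ⊆ A := by
      by_contra hcon
      exact hSx v hv (if_neg hcon)
    exact h (mem_filter.mpr ⟨hj, he⟩)
  · have h : Disjoint (N' w) A := by
      by_contra hcon
      exact hTy w hw (if_neg hcon)
    exact Finset.disjoint_left.mp h (mem_filter.mpr ⟨hj, hf⟩)

open Finset in
lemma card_eq_sum_card_left {α β : Type*} [Fintype α] [Fintype β] [DecidableEq α] [DecidableEq β]
    (E : Finset (α × β)) : #E = ∑ j : β, #{v : α | (v, j) ∈ E} := by
  simp_rw [card_filter]
  rw [sum_comm, ← Fintype.sum_prod_type (fun p : α × β => if p ∈ E then 1 else 0), ← card_filter]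
  simp

open Finset in
lemma card_eq_sum_card_right {α β : Type*} [Fintype α] [Fintype β] [DecidableEq α] [DecidableEq β]
    (E : Finset (α × β)) : #E = ∑ j : α, #{w : β | (j, w) ∈ E} := by
  simp_rw [card_filter]
  rw [← Fintype.sum_prod_type (fun p : α × β => if p ∈ E then 1 else 0), ← card_filter]
  simp

open Finset in
/-- At most a quarter of `k` indices have a value exceeding `4 / k` times the total. -/
lemma four_mul_card_le {ι : Type*} [Fintype ι] (d : ι → ℕ) {s : ℝ} {k : ℕ} (hs : 0 < s)
    (hsum : ((∑ j, d j : ℕ) : ℝ) = s) : 4 * #{j | 4 * s < k * (d j : ℝ)} ≤ k := by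
  have h : (#{j | 4 * s < k * (d j : ℝ)} : ℝ) * (4 * s) ≤ k * s := by
    have hsum' : k * s = ∑ j, k * (d j : ℝ) := by
      rw [← hsum, ← mul_sum]
      push_cast
      rfl
    rw [hsum', ← nsmul_eq_mul]
    exact (card_nsmul_le_sum _ (fun j => (k : ℝ) * d j) _ fun j hj => (mem_filter.mp hj).2.le).trans
      (sum_le_sum_of_subset_of_nonneg (subset_univ _) fun _ _ _ => by positivity)
  have hle : (4 * #{j | 4 * s < k * (d j : ℝ)} : ℝ) ≤ k :=
    le_of_mul_le_mul_right (by linarith) hs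
  exact_mod_cast hle

open Finset in
/-- The middle vertices whose degrees are relevant for joining sets of size about `k`. -/
noncomputable def mediumVertices {n m : ℕ} (E1 : Finset (Fin n × Fin m))
    (E2 : Finset (Fin m × Fin n)) (a b : ℝ) (k : ℕ) : Finset (Fin m) :=
  {j | n < 128 * k * b * (#{v | (v, j) ∈ E1} : ℝ) ∧ k * (#{v | (v, j) ∈ E1} : ℝ) ≤ 4 * (a * n) ∧
    k * (#{w | (j, w) ∈ E2} : ℝ) ≤ 4 * (b * n)}

open Finset in
/-- In a superconcentrator, the medium vertices at each scale carry many edges. -/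
lemma IsDepthTwoSC.lt_sum_or_lt_sum {n m k : ℕ} {E1 : Finset (Fin n × Fin m)}
    {E2 : Finset (Fin m × Fin n)} {a b c d P : ℝ} (h : IsDepthTwoSC n m E1 E2)
    (h1 : (#E1 : ℝ) = a * n) (h2 : (#E2 : ℝ) = b * n) (hn : 0 < n) (hk : 0 < k) (hk_le : k ≤ n)
    (ha : 0 < a) (hb : 0 < b) (hc : 0 < c) (hd : 0 < d)
    (hP : ((a + b) / a) ^ (2 * c) ≤ P) (hP' : ((a + b) / b) ^ (2 * d) ≤ P)
    (hck : 512 * c * a * P ≤ k) (hdk : 512 * d * b * P ≤ k) (hkn : 8 * k * P ≤ n) :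
    c * n < ∑ j ∈ mediumVertices E1 E2 a b k, (#{v | (v, j) ∈ E1} : ℝ) ∨
      d * n < ∑ j ∈ mediumVertices E1 E2 a b k, (#{w | (j, w) ∈ E2} : ℝ) := by
  classical
  by_contra! hcon
  have hn' : (0 : ℝ) < n := by exact_mod_cast hn
  have hk' : (0 : ℝ) < k := by exact_mod_cast hk
  rw [card_eq_sum_card_left] at h1
  rw [card_eq_sum_card_right] at h2
  set low : Fin n → Fin n → Prop := fun v w =>
    ∃ j, 128 * k * b * (#{v | (v, j) ∈ E1} : ℝ) ≤ n ∧ (v, j) ∈ E1 ∧ (j, w) ∈ E2 with hlow_def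
  have hlow : (#{p : Fin n × Fin n | low p.1 p.2} : ℝ) ≤ n ^ 2 / (128 * k) := by
    have hsub : ({p : Fin n × Fin n | low p.1 p.2} : Finset _) ⊆
        ({j | 128 * k * b * (#{v | (v, j) ∈ E1} : ℝ) ≤ n} : Finset (Fin m)).biUnion fun j =>
          ({v | (v, j) ∈ E1} : Finset (Fin n)) ×ˢ ({w | (j, w) ∈ E2} : Finset (Fin n)) := by
      intro p hp
      obtain ⟨j, hj, hv, hw⟩ := (mem_filter.mp hp).2
      simp only [mem_biUnion, mem_filter, mem_univ, true_and, mem_product]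
      exact ⟨j, hj, hv, hw⟩
    calc (#{p : Fin n × Fin n | low p.1 p.2} : ℝ)
        ≤ ∑ j : Fin m with 128 * k * b * (#{v | (v, j) ∈ E1} : ℝ) ≤ n,
          (#{v | (v, j) ∈ E1} : ℝ) * #{w | (j, w) ∈ E2} := by
          have := (card_le_card hsub).trans card_biUnion_le
          simp only [card_product] at this
          exact_mod_cast this
      _ ≤ ∑ j : Fin m with 128 * k * b * (#{v | (v, j) ∈ E1} : ℝ) ≤ n,
          (n / (128 * k * b) : ℝ) * #{w | (j, w) ∈ E2} := by
          refine sum_le_sum fun j hj => mul_le_mul_of_nonneg_right ?_ (by positivity)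
          rw [le_div_iff₀ (by positivity)]
          linarith [(mem_filter.mp hj).2]
      _ ≤ ∑ j : Fin m, (n / (128 * k * b) : ℝ) * #{w | (j, w) ∈ E2} :=
          sum_le_sum_of_subset_of_nonneg (subset_univ _) fun _ _ _ => by positivity
      _ = n / (128 * k * b) * (b * n) := by
          rw [← mul_sum, ← h2]
          push_cast
          rfl
      _ = n ^ 2 / (128 * k) := by field_simp
  obtain ⟨S, T, A, hS, hT, hSA, hTA, hST⟩ := exists_separated_sets (mediumVertices E1 E2 a b k)
    (fun v j => (v, j) ∈ E1) (fun w j => (j, w) ∈ E2) low (n := n) (k := k)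
    (q := a / (a + b)) (r := b / (a + b)) (c := c) (d := d) (D := 4 * (a * n) / k)
    (D' := 4 * (b * n) / k) (P := P) (Fintype.card_fin n) (Fintype.card_fin n) hn hk
    (by positivity) (by positivity) (by field_simp) hc hd (by positivity) (by positivity)
    hcon.1 hcon.2
    (fun j hj => by
      rw [le_div_iff₀ hk', mul_comm]
      exact (mem_filter.mp hj).2.2.1)
    (fun j hj => by
      rw [le_div_iff₀ hk', mul_comm]
      exact (mem_filter.mp hj).2.2.2)
    (by rwa [inv_div]) (by rwa [inv_div])
    (by
      calc 128 * c * (4 * (a * n) / k) * P = (512 * c * a * P) * n / k := by ring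
        _ ≤ k * n / k := by gcongr
        _ = n := by field_simp)
    (by
      calc 128 * d * (4 * (b * n) / k) * P = (512 * d * b * P) * n / k := by ring
        _ ≤ k * n / k := by gcongr
        _ = n := by field_simp)
    hlow hkn
  obtain ⟨vs, ms, ws, -, hms, -, hpath⟩ := h k hk hk_le S T hS hT
  have hH1 := four_mul_card_le (fun j => #{v | (v, j) ∈ E1}) (k := k) (by positivity) h1
  have hH2 := four_mul_card_le (fun j => #{w | (j, w) ∈ E2}) (k := k) (by positivity) h2
  set H1 : Finset (Fin m) := {j | 4 * (a * n) < k * (#{v | (v, j) ∈ E1} : ℝ)}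
  set H2 : Finset (Fin m) := {j | 4 * (b * n) < k * (#{w | (j, w) ∈ E2} : ℝ)}
  obtain ⟨i, hi⟩ : ∃ i, ms i ∉ H1 ∪ H2 := by
    by_contra! hall
    have h3 : #((univ : Finset (Fin k)).image ms) ≤ #(H1 ∪ H2) :=
      card_le_card fun j hj => by
        obtain ⟨i, -, rfl⟩ := mem_image.mp hj
        exact hall i
    rw [card_image_of_injective _ hms, card_univ, Fintype.card_fin] at h3
    have h4 := card_union_le H1 H2
    omega
  obtain ⟨hvS, hwT, he1, he2⟩ := hpath i
  simp only [H1, H2, mem_union, mem_filter, mem_univ, true_and, not_or, not_lt] at hi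
  by_cases hmed : (n : ℝ) < 128 * k * b * (#{v | (v, ms i) ∈ E1} : ℝ)
  · have hM : ms i ∈ mediumVertices E1 E2 a b k :=
      mem_filter.mpr ⟨mem_univ _, hmed, hi.1, hi.2⟩
    exact hTA _ hwT _ hM he2 (hSA _ hvS _ hM he1)
  · exact hST _ hvS _ hwT ⟨ms i, not_lt.mp hmed, he1, he2⟩

lemma IsDepthTwoSC.le_card {n m : ℕ} {E1 : Finset (Fin n × Fin m)} {E2 : Finset (Fin m × Fin n)}
    (h : IsDepthTwoSC n m E1 E2) (hn : 1 ≤ n) : n ≤ E1.card := by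
  obtain ⟨vs, ms, ws, hvs, -, -, hpath⟩ :=
    h n hn le_rfl Finset.univ Finset.univ (by simp) (by simp)
  have := Finset.card_le_card_of_injOn (s := (Finset.univ : Finset (Fin n))) (t := E1)
    (fun i => (vs i, ms i)) (fun i _ => (hpath i).2.2.1)
    fun i _ j _ hij => hvs (Prod.mk.inj hij).1
  simpa using this

lemma log_le_mul_log_add_div {a b : ℝ} (ha : 1 ≤ a) (hb : 0 < b) :
    Real.log b ≤ a * Real.log ((a + b) / a) := by
  have ha0 : 0 < a := by linarith
  have hba : 0 < b / a := by positivity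
  have h := one_add_mul_self_le_rpow_one_add (s := b / a) (by linarith) ha
  have e : a * (b / a) = b := by field_simp
  have e' : 1 + b / a = (a + b) / a := by field_simp
  rw [e, e'] at h
  rw [← Real.log_rpow (by positivity)]
  exact Real.log_le_log hb (by linarith)

lemma mul_log_add_div_le {a b : ℝ} (ha : 0 < a) (hb : 0 < b) :
    a * Real.log ((a + b) / a) ≤ b := by
  have h := Real.log_le_sub_one_of_pos (x := (a + b) / a) (by positivity)
  have e : a * ((a + b) / a - 1) = b := by field_simp; ring
  calc _ ≤ a * ((a + b) / a - 1) := mul_le_mul_of_nonneg_left h ha.le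
    _ = b := e

lemma half_le_log_add_div {a b : ℝ} (ha : 0 < a) (hab : a ≤ b) :
    1 / 2 ≤ Real.log ((a + b) / a) := by
  have h2 : (2 : ℝ) ≤ (a + b) / a := by
    rw [le_div_iff₀ ha]
    linarith
  have := Real.log_le_log (by norm_num) h2
  linarith [Real.log_two_gt_d9]

open Finset in
/-- Medium vertices at well separated scales are distinct. -/
lemma mediumVertices_disjoint {n m k k' : ℕ} {E1 : Finset (Fin n × Fin m)}
    {E2 : Finset (Fin m × Fin n)} {a b : ℝ} (ha : 0 < a)
    (hk : 512 * (a * b) * k ≤ k') :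
    Disjoint (mediumVertices E1 E2 a b k) (mediumVertices E1 E2 a b k') := by
  rw [Finset.disjoint_left]
  intro j hj hj'
  have h1 := (mem_filter.mp hj).2.1
  have h2 := (mem_filter.mp hj').2.2.1
  set x : ℝ := (#{v | (v, j) ∈ E1} : ℝ)
  have hx : 0 ≤ x := by positivity
  have h3 : 512 * (a * b) * k * x ≤ k' * x := mul_le_mul_of_nonneg_right hk hx
  nlinarith [mul_lt_mul_of_pos_left h1 ha]

open Finset in
lemma sum_sum_mediumVertices_le {n m r : ℕ} {E1 : Finset (Fin n × Fin m)}
    {E2 : Finset (Fin m × Fin n)} {a b : ℝ} (K : ℕ → ℕ)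
    (hK : ∀ i j, i < j → Disjoint (mediumVertices E1 E2 a b (K i)) (mediumVertices E1 E2 a b (K j)))
    (d : Fin m → ℝ) (hd : ∀ j, 0 ≤ d j) :
    ∑ i ∈ range r, ∑ j ∈ mediumVertices E1 E2 a b (K i), d j ≤ ∑ j, d j := by
  classical
  rw [← sum_biUnion]
  · exact sum_le_sum_of_subset_of_nonneg (subset_univ _) fun j _ _ => hd j
  · intro i _ j _ hij
    rcases lt_or_gt_of_ne hij with h | h
    · exact hK i j h
    · exact (hK j i h).symm

lemma inv_two_mul_le_log_add_div {a b : ℝ} (ha : 1 ≤ a) (hab : a ≤ b) :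
    1 / (2 * b) ≤ Real.log ((a + b) / b) := by
  have ha0 : 0 < a := by linarith
  have hb0 : 0 < b := by linarith
  refine le_trans ?_ (Real.one_sub_inv_le_log_of_pos (x := (a + b) / b) (by positivity))
  have e : 1 - ((a + b) / b)⁻¹ = a / (a + b) := by field_simp; ring
  rw [e, div_le_div_iff₀ (by positivity) (by positivity)]
  nlinarith

open Finset in
/-- A lower bound on the number of edges at the medium vertices of a single scale. -/
lemma IsDepthTwoSC.log_le_sum_add_sum {n m k : ℕ} {E1 : Finset (Fin n × Fin m)}
    {E2 : Finset (Fin m × Fin n)} {a b t : ℝ} (h : IsDepthTwoSC n m E1 E2)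
    (h1 : (#E1 : ℝ) = a * n) (h2 : (#E2 : ℝ) = b * n) (ha : 1 ≤ a) (hab : a ≤ b) (hbt : b ≤ t)
    (ht : 512 ≤ t) (hnt : (n : ℝ) = t ^ 16) (hk : t ^ 8 ≤ k) (hk' : (k : ℝ) ≤ t ^ 14) :
    Real.log t * n ≤
      2 * Real.log ((a + b) / a) *
        ∑ j ∈ mediumVertices E1 E2 a b k, (#{v | (v, j) ∈ E1} : ℝ) +
      2 * Real.log ((a + b) / b) *
        ∑ j ∈ mediumVertices E1 E2 a b k, (#{w | (j, w) ∈ E2} : ℝ) := by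
  have ha0 : 0 < a := by linarith
  have hb0 : 0 < b := by linarith
  have ht0 : 0 < t := by linarith
  have hn' : (0 : ℝ) < n := by rw [hnt]; exact pow_pos ht0 _
  have hkpos : (0 : ℝ) < k := lt_of_lt_of_le (pow_pos ht0 _) hk
  have hlt : 0 < Real.log t := Real.log_pos (by linarith)
  have hltt : Real.log t ≤ t := by linarith [Real.log_le_sub_one_of_pos ht0]
  have hLh : 1 / 2 ≤ Real.log ((a + b) / a) := half_le_log_add_div ha0 hab
  have hL'0 : 1 / (2 * b) ≤ Real.log ((a + b) / b) := inv_two_mul_le_log_add_div ha hab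
  have hL'p : 0 < Real.log ((a + b) / b) := lt_of_lt_of_le (by positivity) hL'0
  have hexp : Real.exp (Real.log ((a + b) / a)) = (a + b) / a := Real.exp_log (by positivity)
  have hexp' : Real.exp (Real.log ((a + b) / b)) = (a + b) / b := Real.exp_log (by positivity)
  obtain ⟨L, hL⟩ : ∃ L, L = Real.log ((a + b) / a) := ⟨_, rfl⟩
  obtain ⟨L', hL'⟩ : ∃ L', L' = Real.log ((a + b) / b) := ⟨_, rfl⟩
  rw [← hL] at hLh hexp ⊢
  rw [← hL'] at hL'0 hL'p hexp' ⊢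
  have hLp : 0 < L := by linarith
  obtain ⟨c, hc⟩ : ∃ c, L * (2 * c) = Real.log t := ⟨Real.log t / (2 * L), by field_simp⟩
  obtain ⟨d, hd⟩ : ∃ d, L' * (2 * d) = Real.log t := ⟨Real.log t / (2 * L'), by field_simp⟩
  have hc0 : 0 < c := by
    have : 0 < 2 * c := pos_of_mul_pos_right (by rwa [hc]) hLp.le
    linarith
  have hd0 : 0 < d := by
    have : 0 < 2 * d := pos_of_mul_pos_right (by rwa [hd]) hL'p.le
    linarith
  have hct : c ≤ t := by nlinarith
  have hdt : d ≤ t ^ 2 := by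
    rw [div_le_iff₀ (by positivity)] at hL'0
    have h4 : d ≤ b * Real.log t := by
      rw [← hd]
      nlinarith
    calc d ≤ b * Real.log t := h4
      _ ≤ t * t := mul_le_mul hbt hltt hlt.le ht0.le
      _ = t ^ 2 := by ring
  have h512 : 512 * t ^ 4 ≤ t ^ 8 := by
    have : (512 : ℝ) ≤ t ^ 4 := ht.trans (le_self_pow₀ (by linarith) (by norm_num))
    calc 512 * t ^ 4 ≤ t ^ 4 * t ^ 4 := mul_le_mul_of_nonneg_right this (pow_pos ht0 4).le
      _ = t ^ 8 := by ring
  have h8 : 8 * k * t ≤ (n : ℝ) := by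
    calc 8 * k * t = k * (8 * t) := by ring
      _ ≤ t ^ 14 * (t * t) :=
        mul_le_mul hk' (by nlinarith) (by positivity) (pow_pos ht0 _).le
      _ = n := by rw [hnt]; ring
  have hkn : k ≤ n := by
    have : (k : ℝ) ≤ n := by nlinarith
    exact_mod_cast this
  have key := h.lt_sum_or_lt_sum (P := t) h1 h2 (by exact_mod_cast hn') (by exact_mod_cast hkpos)
    hkn ha0 hb0 hc0 hd0
    (by rw [← hexp, ← Real.exp_mul, hc, Real.exp_log ht0])
    (by rw [← hexp', ← Real.exp_mul, hd, Real.exp_log ht0])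
    (by
      refine le_trans ?_ (h512.trans hk)
      calc 512 * c * a * t = 512 * (c * a) * t := by ring
        _ ≤ 512 * (t * t) * t := mul_le_mul_of_nonneg_right (mul_le_mul_of_nonneg_left
            (mul_le_mul hct (hab.trans hbt) ha0.le ht0.le) (by norm_num)) ht0.le
        _ = 512 * t ^ 3 := by ring
        _ ≤ 512 * t ^ 4 := mul_le_mul_of_nonneg_left
            (pow_le_pow_right₀ (by linarith) (by norm_num)) (by norm_num))
    (by
      refine le_trans ?_ (h512.trans hk)
      calc 512 * d * b * t = 512 * (d * b) * t := by ring
        _ ≤ 512 * (t ^ 2 * t) * t := mul_le_mul_of_nonneg_right (mul_le_mul_of_nonneg_left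
            (mul_le_mul hdt hbt hb0.le (pow_pos ht0 2).le) (by norm_num)) ht0.le
        _ = 512 * t ^ 4 := by ring)
    h8
  have hp1 : 0 ≤ 2 * L * ∑ j ∈ mediumVertices E1 E2 a b k, (#{v | (v, j) ∈ E1} : ℝ) :=
    mul_nonneg (by linarith) (sum_nonneg fun _ _ => Nat.cast_nonneg _)
  have hp2 : 0 ≤ 2 * L' * ∑ j ∈ mediumVertices E1 E2 a b k, (#{w | (j, w) ∈ E2} : ℝ) :=
    mul_nonneg (by linarith) (sum_nonneg fun _ _ => Nat.cast_nonneg _)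
  rcases key with key | key
  · have h3 := mul_lt_mul_of_pos_left key (by linarith : 0 < 2 * L)
    have h4 : 2 * L * (c * n) = Real.log t * n := by rw [← hc]; ring
    linarith
  · have h3 := mul_lt_mul_of_pos_left key (by linarith : 0 < 2 * L')
    have h4 : 2 * L' * (d * n) = Real.log t * n := by rw [← hd]; ring
    linarith

open Finset in
/-- The number of well separated scales is bounded in terms of the average degrees. -/
lemma IsDepthTwoSC.scales_le {n m r k₀ R : ℕ} {E1 : Finset (Fin n × Fin m)}
    {E2 : Finset (Fin m × Fin n)} {a b t : ℝ} (h : IsDepthTwoSC n m E1 E2)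
    (h1 : (#E1 : ℝ) = a * n) (h2 : (#E2 : ℝ) = b * n) (ha : 1 ≤ a) (hab : a ≤ b) (hbt : b ≤ t)
    (ht : 512 ≤ t) (hnt : (n : ℝ) = t ^ 16) (hR : 512 * b ^ 2 ≤ R) (hk₀ : t ^ 8 ≤ k₀)
    (hk₀R : ∀ i < r, (k₀ * R ^ i : ℝ) ≤ t ^ 14) :
    r * Real.log t ≤ 6 * (a * Real.log ((a + b) / a)) := by
  have ha0 : 0 < a := by linarith
  have hb0 : 0 < b := by linarith
  have ht0 : 0 < t := by linarith
  have hn' : (0 : ℝ) < n := by rw [hnt]; exact pow_pos ht0 _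
  have hR0 : 1 ≤ R := by
    have : (1 : ℝ) ≤ R := by nlinarith
    exact_mod_cast this
  have hdisj : ∀ i j, i < j → Disjoint (mediumVertices E1 E2 a b (k₀ * R ^ i))
      (mediumVertices E1 E2 a b (k₀ * R ^ j)) := by
    intro i j hij
    refine mediumVertices_disjoint ha0 ?_
    have h3 : R * (k₀ * R ^ i) ≤ k₀ * R ^ j := by
      calc R * (k₀ * R ^ i) = k₀ * R ^ (i + 1) := by ring
        _ ≤ k₀ * R ^ j := Nat.mul_le_mul_left _ (Nat.pow_le_pow_right hR0 hij)
    have h3' : (R : ℝ) * (k₀ * R ^ i : ℕ) ≤ (k₀ * R ^ j : ℕ) := by exact_mod_cast h3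
    refine le_trans (mul_le_mul_of_nonneg_right ?_ (Nat.cast_nonneg _)) h3'
    nlinarith
  have hsum := sum_le_sum fun i (hi : i ∈ range r) =>
    h.log_le_sum_add_sum (k := k₀ * R ^ i) h1 h2 ha hab hbt ht hnt
      (hk₀.trans (by exact_mod_cast Nat.le_mul_of_pos_right k₀ (pow_pos hR0 i)))
      (by exact_mod_cast hk₀R i (mem_range.mp hi))
  rw [sum_const, card_range, nsmul_eq_mul, sum_add_distrib, ← mul_sum, ← mul_sum] at hsum
  have hA := sum_sum_mediumVertices_le (r := r) (fun i => k₀ * R ^ i) hdisj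
    (fun j => (#{v | (v, j) ∈ E1} : ℝ)) fun _ => Nat.cast_nonneg _
  have hB := sum_sum_mediumVertices_le (r := r) (fun i => k₀ * R ^ i) hdisj
    (fun j => (#{w | (j, w) ∈ E2} : ℝ)) fun _ => Nat.cast_nonneg _
  rw [card_eq_sum_card_left] at h1
  rw [card_eq_sum_card_right] at h2
  rw [Nat.cast_sum] at h1 h2
  rw [h1] at hA
  rw [h2] at hB
  have hL := half_le_log_add_div ha0 hab
  have hL' : 0 < Real.log ((a + b) / b) :=
    lt_of_lt_of_le (by positivity) (inv_two_mul_le_log_add_div ha hab)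
  have hbL' : b * Real.log ((a + b) / b) ≤ a := by
    have := mul_log_add_div_le hb0 ha0
    rwa [add_comm b a] at this
  have hA' := mul_le_mul_of_nonneg_left hA (by linarith : 0 ≤ 2 * Real.log ((a + b) / a))
  have hB' := mul_le_mul_of_nonneg_left hB (by linarith : 0 ≤ 2 * Real.log ((a + b) / b))
  have hr : r * Real.log t ≤ 2 * (a * Real.log ((a + b) / a)) +
      2 * (b * Real.log ((a + b) / b)) := by
    refine le_of_mul_le_mul_right ?_ hn'
    linarith
  nlinarith

/-- The tradeoff in terms of the logarithm of `n ^ (1 / 16)`. -/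
lemma IsDepthTwoSC.log_sq_le {n m : ℕ} {E1 : Finset (Fin n × Fin m)}
    {E2 : Finset (Fin m × Fin n)} {a b t : ℝ} (h : IsDepthTwoSC n m E1 E2)
    (h1 : (E1.card : ℝ) = a * n) (h2 : (E2.card : ℝ) = b * n) (ha : 1 ≤ a) (hab : a ≤ b)
    (ht : 0 < t) (hlogt : 3078 ≤ Real.log t) (hnt : (n : ℝ) = t ^ 16) :
    Real.log t ^ 2 ≤ 6 * (a * Real.log ((a + b) / a) * Real.log b) := by
  have ha0 : 0 < a := by linarith
  have hb0 : 0 < b := by linarith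
  have hbf := log_le_mul_log_add_div ha hb0
  have hfb := mul_log_add_div_le ha0 hb0
  have ht513 : 513 ≤ t := by linarith [Real.log_le_sub_one_of_pos ht]
  set F := a * Real.log ((a + b) / a) with hF
  have hlt : 0 < Real.log t := by linarith
  rcases lt_or_ge t b with hbt | hbt
  · have h3 : Real.log t ≤ Real.log b := Real.log_le_log ht hbt.le
    nlinarith
  set R := ⌈512 * b ^ 2⌉₊ with hR
  have hb1 : 1 ≤ b := by linarith
  have hRl : 512 * b ^ 2 ≤ R := Nat.le_ceil _
  have hRu : (R : ℝ) ≤ 513 * b ^ 2 := by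
    have := Nat.ceil_lt_add_one (a := 512 * b ^ 2) (by positivity)
    nlinarith
  have hR1 : (512 : ℝ) ≤ R := by nlinarith
  have hlR : 0 < Real.log R := Real.log_pos (by linarith)
  set k₀ := ⌈t ^ 8⌉₊ with hk₀
  have hk₀l : t ^ 8 ≤ k₀ := Nat.le_ceil _
  have hk₀u : (k₀ : ℝ) ≤ t ^ 9 := by
    have h3 := Nat.ceil_lt_add_one (a := t ^ 8) (by positivity)
    have h4 : (1 : ℝ) ≤ t ^ 8 := one_le_pow₀ (by linarith)
    have h5 : t ^ 9 = t ^ 8 * t := by ring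
    nlinarith
  set r := ⌊5 * Real.log t / Real.log R⌋₊ + 1 with hr
  have hmain := h.scales_le (r := r) (k₀ := k₀) (R := R) h1 h2 ha hab hbt (by linarith) hnt hRl
    hk₀l (by
      intro i hi
      have hi' : (i : ℝ) ≤ 5 * Real.log t / Real.log R :=
        (Nat.cast_le.mpr (Nat.lt_succ_iff.mp hi)).trans (Nat.floor_le (by positivity))
      rw [le_div_iff₀ hlR] at hi'
      have h3 : (R : ℝ) ^ i ≤ t ^ 5 := by
        rw [← Real.log_le_log_iff (by positivity) (by positivity), Real.log_pow, Real.log_pow]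
        exact_mod_cast hi'
      calc (k₀ * R ^ i : ℝ) ≤ t ^ 9 * t ^ 5 := by gcongr
        _ = t ^ 14 := by ring)
  have hr5 : 5 * Real.log t ≤ r * Real.log R := by
    rw [← div_le_iff₀ hlR, hr]
    push_cast
    exact (Nat.lt_floor_add_one _).le
  have hkey : 5 * Real.log t ^ 2 ≤ 6 * F * Real.log R := by
    nlinarith [mul_le_mul_of_nonneg_right hmain hlR.le, mul_le_mul_of_nonneg_right hr5 hlt.le]
  have hlR3 : Real.log R ≤ 3 * Real.log t := by
    have : (R : ℝ) ≤ t ^ 3 := by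
      calc (R : ℝ) ≤ 513 * b ^ 2 := hRu
        _ ≤ t * t ^ 2 := by gcongr
        _ = t ^ 3 := by ring
    calc Real.log R ≤ Real.log (t ^ 3) := Real.log_le_log (by linarith) this
      _ = 3 * Real.log t := by rw [Real.log_pow]; norm_num
  have hF0 : 0 ≤ F := (Real.log_nonneg hb1).trans hbf
  have hb513 : 513 ≤ b := by
    have h3 : 5 * Real.log t ^ 2 ≤ 18 * b * Real.log t := by
      calc 5 * Real.log t ^ 2 ≤ 6 * F * Real.log R := hkey
        _ ≤ 6 * b * (3 * Real.log t) := by gcongr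
        _ = _ := by ring
    have h4 : 5 * Real.log t ≤ 18 * b := le_of_mul_le_mul_right (by linarith) hlt
    linarith
  have hlRb : Real.log R ≤ 3 * Real.log b := by
    have : (R : ℝ) ≤ b ^ 3 := by
      calc (R : ℝ) ≤ 513 * b ^ 2 := hRu
        _ ≤ b * b ^ 2 := by gcongr
        _ = b ^ 3 := by ring
    calc Real.log R ≤ Real.log (b ^ 3) := Real.log_le_log (by linarith) this
      _ = 3 * Real.log b := by rw [Real.log_pow]; norm_num
  nlinarith [mul_le_mul_of_nonneg_left hlRb hF0]

/-- Dutta–Radhakrishnan tradeoff: there exists `c > 0` such that for all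
sufficiently large `n`, if `G = (V, M, W, E)` is a depth-two `n`-superconcentrator
with the average degree of vertices in `V` equal to `a` (i.e. the number of edges
from `V` to `M` is `a·n`), the average degree of vertices in `W` equal to `b`
(i.e. the number of edges from `M` to `W` is `b·n`), and `a ≤ b`, then
`a · log((a + b)/a) · log b ≥ c · (log n)²`. -/
theorem stmt_11 :
    ∃ c : ℝ, c > 0 ∧ ∃ N : ℕ, ∀ n : ℕ, N ≤ n →
      ∀ m : ℕ, ∀ E1 : Finset (Fin n × Fin m), ∀ E2 : Finset (Fin m × Fin n),
      ∀ a b : ℝ,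
      IsDepthTwoSC n m E1 E2 →
      (E1.card : ℝ) = a * n → (E2.card : ℝ) = b * n → a ≤ b →
        a * Real.log ((a + b) / a) * Real.log b ≥ c * (Real.log n) ^ 2 := by
  refine ⟨1 / 1536, by norm_num, ⌈Real.exp 49248⌉₊, ?_⟩
  intro n hN m E1 E2 a b h h1 h2 hab
  have hnN : Real.exp 49248 ≤ n := (Nat.le_ceil _).trans (Nat.cast_le.mpr hN)
  have hn0 : (0 : ℝ) < n := (Real.exp_pos _).trans_le hnN
  have hlog : 49248 ≤ Real.log n := (Real.le_log_iff_exp_le hn0).mpr hnN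
  have ha : 1 ≤ a := by
    have h3 : n ≤ E1.card := h.le_card (by exact_mod_cast hn0)
    have h4 : (n : ℝ) ≤ a * n := by
      rw [← h1]
      exact_mod_cast h3
    exact le_of_mul_le_mul_right (by linarith) hn0
  have key := h.log_sq_le (t := Real.exp (Real.log n / 16)) h1 h2 ha hab (Real.exp_pos _)
    (by rw [Real.log_exp]; linarith)
    (by rw [← Real.exp_nat_mul, Nat.cast_ofNat, mul_div_cancel₀ _ (by norm_num), Real.exp_log hn0])
  rw [Real.log_exp] at key
  linarith
end

section
/- There exist constants c, c' > 0 such that the following holds for all sufficiently large n: let G = (V, M, W, E) be a depth-two n-superconcentrator in which every vertex v ∈ M has the same number deg(v) of edges coming from V as going to W, and suppose |E| ≤ c' · n · (log n)² / log log n. Then for every k with n^{1/4} ≤ k ≤ n^{3/4}, the number of edges of G incident on the set Medium(k) := { v ∈ M : (n/k)(log n)^{-2} ≤ deg(v) < (n/k)(log n)² } is at least c · n · log n. -/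
open Finset in
theorem card_filter_subset_eq {ι : Type*} [Fintype ι] [DecidableEq ι] (A : Finset ι) :
    (#{ω : Finset ι | A ⊆ ω} : ℝ) = 2 ^ Fintype.card ι / 2 ^ #A := by
  have h : ({ω : Finset ι | A ⊆ ω} : Finset (Finset ι)) = Icc A univ := by
    ext ω; simp
  rw [h, card_Icc_finset (subset_univ A), card_univ, Nat.cast_pow, Nat.cast_ofNat,
    pow_sub₀ _ two_ne_zero (card_le_univ A), div_eq_mul_inv]

open Finset in
theorem card_filter_subset_disjoint_le {ι : Type*} [Fintype ι] [DecidableEq ι]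
    (A B : Finset ι) :
    (#{ω : Finset ι | A ⊆ ω ∧ B ⊆ ωᶜ} : ℝ) ≤ 2 ^ Fintype.card ι / (2 ^ #A * 2 ^ #B) := by
  have h : ({ω : Finset ι | A ⊆ ω ∧ B ⊆ ωᶜ} : Finset (Finset ι)) = Icc A Bᶜ := by
    ext ω; simp [subset_compl_comm]
  rw [h]
  by_cases hAB : A ⊆ Bᶜ
  · have hle := card_le_card hAB
    have hB := card_le_univ B
    rw [card_compl] at hle
    rw [card_Icc_finset hAB, card_compl, Nat.cast_pow, Nat.cast_ofNat,
      pow_sub₀ _ two_ne_zero hle, pow_sub₀ _ two_ne_zero hB]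
    apply le_of_eq
    field_simp
  · rw [Icc_eq_empty hAB]
    simp only [card_empty, Nat.cast_zero]
    positivity

open Finset in
/-- The variance of the number of sets of a uniform family contained in a random set. -/
theorem sum_sq_card_filter_subset_sub {α ι : Type*} [Fintype ι] [DecidableEq ι]
    (G : Finset α) (A : α → Finset ι) (D : ℕ) (hA : ∀ x ∈ G, #(A x) = D) :
    ∑ ω : Finset ι, ((#{x ∈ G | A x ⊆ ω} : ℝ) - #G / 2 ^ D) ^ 2 =
      2 ^ Fintype.card ι / (2 ^ D) ^ 2 *
        (∑ x ∈ G, ∑ y ∈ G, (2 : ℝ) ^ #(A x ∩ A y) - (#G : ℝ) ^ 2) := by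
  have hX : ∀ ω : Finset ι, (#{x ∈ G | A x ⊆ ω} : ℝ) = ∑ x ∈ G, if A x ⊆ ω then 1 else 0 := by
    intro ω; simp
  have h1 : ∑ ω : Finset ι, (#{x ∈ G | A x ⊆ ω} : ℝ) =
      2 ^ Fintype.card ι * (#G / 2 ^ D) := by
    simp_rw [hX]
    rw [sum_comm]
    rw [sum_congr rfl (g := fun _ => (2 : ℝ) ^ Fintype.card ι / 2 ^ D)]
    · simp; ring
    · intro x hx
      rw [← hA x hx, ← card_filter_subset_eq]
      simp
  have h2 : ∑ ω : Finset ι, (#{x ∈ G | A x ⊆ ω} : ℝ) ^ 2 =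
      2 ^ Fintype.card ι / (2 ^ D) ^ 2 * ∑ x ∈ G, ∑ y ∈ G, (2 : ℝ) ^ #(A x ∩ A y) := by
    simp_rw [hX, sq, sum_mul_sum]
    rw [sum_comm, mul_sum]
    refine sum_congr rfl fun x hx => ?_
    rw [sum_comm, mul_sum]
    refine sum_congr rfl fun y hy => ?_
    have h3 : ∑ ω : Finset ι, ((if A x ⊆ ω then (1 : ℝ) else 0) * if A y ⊆ ω then 1 else 0) =
        (#{ω : Finset ι | A x ∪ A y ⊆ ω} : ℝ) := by
      rw [card_filter, Nat.cast_sum]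
      refine sum_congr rfl fun ω _ => ?_
      by_cases h : A x ⊆ ω <;> by_cases h' : A y ⊆ ω <;> simp [union_subset_iff, h, h']
    rw [h3, card_filter_subset_eq]
    have h4 := card_union_add_card_inter (A x) (A y)
    rw [hA x hx, hA y hy] at h4
    have h5 : (2 : ℝ) ^ #(A x ∪ A y) * 2 ^ #(A x ∩ A y) = 2 ^ D * 2 ^ D := by
      rw [← pow_add, ← pow_add, h4]
    field_simp
    linear_combination -h5
  simp_rw [sub_sq, sum_add_distrib, sum_sub_distrib, h2]
  simp_rw [mul_assoc, ← mul_sum, ← sum_mul, h1]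
  simp
  field_simp
  ring

open Finset in
/-- A second moment argument: some set `ω` contains many of the sets `A x`, avoids many of the
sets `B y`, and few of the pairs listed by `T` are selected. -/
theorem exists_finset_many_subset {α β τ ι : Type*} [Fintype ι] [DecidableEq ι]
    (G : Finset α) (H : Finset β) (A : α → Finset ι) (B : β → Finset ι) (D : ℕ)
    (hA : ∀ x ∈ G, #(A x) = D) (hB : ∀ y ∈ H, #(B y) = D)
    (hAA : ∑ x ∈ G, ∑ y ∈ G, (2 : ℝ) ^ #(A x ∩ A y) ≤ (#G : ℝ) ^ 2 + (#G : ℝ) ^ 2 / 16)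
    (hBB : ∑ x ∈ H, ∑ y ∈ H, (2 : ℝ) ^ #(B x ∩ B y) ≤ (#H : ℝ) ^ 2 + (#H : ℝ) ^ 2 / 16)
    (T : Finset τ) (f : τ → α) (g : τ → β) (hf : ∀ t ∈ T, f t ∈ G) (hg : ∀ t ∈ T, g t ∈ H)
    (k : ℕ) (hk : 0 < k) (hG : 2 * k * 2 ^ D ≤ (#G : ℝ)) (hH : 2 * k * 2 ^ D ≤ (#H : ℝ))
    (hT : (#T : ℝ) ≤ (2 ^ D) ^ 2 * (k / 16)) :
    ∃ ω : Finset ι, k ≤ #{x ∈ G | A x ⊆ ω} ∧ k ≤ #{y ∈ H | B y ⊆ ωᶜ} ∧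
      (#{t ∈ T | A (f t) ⊆ ω ∧ B (g t) ⊆ ωᶜ} : ℝ) < k / 4 := by
  by_contra! hcon
  have hk' : (0 : ℝ) < k := by exact_mod_cast hk
  have hG0 : (0 : ℝ) < #G := lt_of_lt_of_le (by positivity) hG
  have hH0 : (0 : ℝ) < #H := lt_of_lt_of_le (by positivity) hH
  set μ : ℝ := #G / 2 ^ D with hμ
  set ν : ℝ := #H / 2 ^ D with hν
  have hμk : 2 * k ≤ μ := by rw [hμ, le_div_iff₀ (by positivity)]; exact hG
  have hνk : 2 * k ≤ ν := by rw [hν, le_div_iff₀ (by positivity)]; exact hH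
  have hμ0 : 0 < μ := by positivity
  have hν0 : 0 < ν := by positivity
  have deviation : ∀ (a b : ℝ), 2 * k ≤ b → a < k → 1 ≤ 4 / b ^ 2 * (a - b) ^ 2 := by
    intro a b hb ha
    have hb0 : 0 < b := by linarith
    rw [div_mul_eq_mul_div, le_div_iff₀ (by positivity)]
    nlinarith
  have hpt : ∀ ω : Finset ι, (1 : ℝ) ≤ 4 / μ ^ 2 * ((#{x ∈ G | A x ⊆ ω} : ℝ) - μ) ^ 2 +
      4 / ν ^ 2 * ((#{y ∈ H | B y ⊆ ωᶜ} : ℝ) - ν) ^ 2 +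
      4 / k * (#{t ∈ T | A (f t) ⊆ ω ∧ B (g t) ⊆ ωᶜ} : ℝ) := by
    intro ω
    have n1 : 0 ≤ 4 / μ ^ 2 * ((#{x ∈ G | A x ⊆ ω} : ℝ) - μ) ^ 2 := by positivity
    have n2 : 0 ≤ 4 / ν ^ 2 * ((#{y ∈ H | B y ⊆ ωᶜ} : ℝ) - ν) ^ 2 := by positivity
    have n3 : 0 ≤ 4 / k * (#{t ∈ T | A (f t) ⊆ ω ∧ B (g t) ⊆ ωᶜ} : ℝ) := by positivity
    by_cases h1 : k ≤ #{x ∈ G | A x ⊆ ω}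
    · by_cases h2 : k ≤ #{y ∈ H | B y ⊆ ωᶜ}
      · have h3 := hcon ω h1 h2
        have : 1 ≤ 4 / k * (#{t ∈ T | A (f t) ⊆ ω ∧ B (g t) ⊆ ωᶜ} : ℝ) := by
          rw [div_mul_eq_mul_div, le_div_iff₀ hk']
          linarith
        linarith
      · have := deviation (#{y ∈ H | B y ⊆ ωᶜ}) ν hνk (by exact_mod_cast not_le.mp h2)
        linarith
    · have := deviation (#{x ∈ G | A x ⊆ ω}) μ hμk (by exact_mod_cast not_le.mp h1)
      linarith
  have hsum := sum_le_sum fun ω (_ : ω ∈ (univ : Finset (Finset ι))) => hpt ω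
  have hreindex : ∑ ω : Finset ι, ((#{y ∈ H | B y ⊆ ωᶜ} : ℝ) - ν) ^ 2 =
      ∑ ω : Finset ι, ((#{y ∈ H | B y ⊆ ω} : ℝ) - ν) ^ 2 :=
    Function.Bijective.sum_comp compl_bijective
      fun ω : Finset ι => ((#{y ∈ H | B y ⊆ ω} : ℝ) - ν) ^ 2
  have hZ : ∑ ω : Finset ι, (#{t ∈ T | A (f t) ⊆ ω ∧ B (g t) ⊆ ωᶜ} : ℝ) ≤
      2 ^ Fintype.card ι / (2 ^ D) ^ 2 * #T := by
    simp_rw [card_filter, Nat.cast_sum]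
    rw [sum_comm]
    calc _ ≤ ∑ t ∈ T, (2 : ℝ) ^ Fintype.card ι / (2 ^ D) ^ 2 := by
          refine sum_le_sum fun t ht => ?_
          have := card_filter_subset_disjoint_le (A (f t)) (B (g t))
          rw [hA _ (hf t ht), hB _ (hg t ht), ← sq, card_filter, Nat.cast_sum] at this
          exact this
      _ = _ := by simp; ring
  rw [sum_add_distrib, sum_add_distrib, ← mul_sum, ← mul_sum, ← mul_sum, hreindex,
    sum_sq_card_filter_subset_sub G A D hA, sum_sq_card_filter_subset_sub H B D hB] at hsum
  simp only [sum_const, card_univ, Fintype.card_finset, nsmul_eq_mul, mul_one, Nat.cast_pow,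
    Nat.cast_ofNat] at hsum
  have hN : (0 : ℝ) < 2 ^ Fintype.card ι := by positivity
  have e1 : 4 / μ ^ 2 * (2 ^ Fintype.card ι / (2 ^ D) ^ 2 *
      (∑ x ∈ G, ∑ y ∈ G, (2 : ℝ) ^ #(A x ∩ A y) - (#G : ℝ) ^ 2)) ≤ 2 ^ Fintype.card ι / 4 := by
    calc _ ≤ 4 / μ ^ 2 * (2 ^ Fintype.card ι / (2 ^ D) ^ 2 * ((#G : ℝ) ^ 2 / 16)) := by
          gcongr; linarith
      _ = _ := by rw [hμ]; field_simp; norm_num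
  have e2 : 4 / ν ^ 2 * (2 ^ Fintype.card ι / (2 ^ D) ^ 2 *
      (∑ x ∈ H, ∑ y ∈ H, (2 : ℝ) ^ #(B x ∩ B y) - (#H : ℝ) ^ 2)) ≤ 2 ^ Fintype.card ι / 4 := by
    calc _ ≤ 4 / ν ^ 2 * (2 ^ Fintype.card ι / (2 ^ D) ^ 2 * ((#H : ℝ) ^ 2 / 16)) := by
          gcongr; linarith
      _ = _ := by rw [hν]; field_simp; norm_num
  have e3 : 4 / k * ∑ ω : Finset ι, (#{t ∈ T | A (f t) ⊆ ω ∧ B (g t) ⊆ ωᶜ} : ℝ) ≤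
      2 ^ Fintype.card ι / 4 := by
    calc _ ≤ 4 / (k : ℝ) * (2 ^ Fintype.card ι / (2 ^ D) ^ 2 * ((2 ^ D) ^ 2 * (k / 16))) := by
          gcongr; exact hZ.trans (by gcongr)
      _ = _ := by field_simp; norm_num
  linarith

open Finset in
/-- The set `R x`, enlarged by private elements of `x` to a set of size `D`. -/
def paddedNeighbors {α β : Type*} (R : α → Finset β) (D : ℕ) (x : α) :
    Finset (β ⊕ α × Fin D) :=
  (R x).disjSum ({x} ×ˢ univ.filter fun i : Fin D => (i : ℕ) < D - #(R x))

open Finset in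
theorem card_paddedNeighbors {α β : Type*} (R : α → Finset β) (D : ℕ) (x : α)
    (h : #(R x) ≤ D) : #(paddedNeighbors R D x) = D := by
  have : #{i : Fin D | (i : ℕ) < D - #(R x)} = D - #(R x) := by
    rw [Fin.card_filter_val_lt]
    omega
  rw [paddedNeighbors, card_disjSum, card_product, card_singleton, this]
  omega

open Finset in
theorem card_paddedNeighbors_inter {α β : Type*} [DecidableEq α] [DecidableEq β]
    (R : α → Finset β) (D : ℕ) {x y : α} (hxy : x ≠ y) :
    #(paddedNeighbors R D x ∩ paddedNeighbors R D y) = #(R x ∩ R y) := by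
  have : paddedNeighbors R D x ∩ paddedNeighbors R D y = (R x ∩ R y).map .inl := by
    ext (b | ⟨z, i⟩)
    · simp [paddedNeighbors]
    · simp [paddedNeighbors]
      grind
  rw [this, card_map]

open Finset in
theorem sum_two_pow_card_paddedNeighbors_inter_le {α β : Type*} [DecidableEq α] [DecidableEq β]
    (R : α → Finset β) (G : Finset α) (d D Δ : ℕ) (hd : ∀ x ∈ G, #(R x) ≤ d) (hD : d ≤ D)
    (hΔ : ∀ x, ∀ b ∈ R x, #{y ∈ G | b ∈ R y} ≤ Δ) :
    ∑ x ∈ G, ∑ y ∈ G, 2 ^ #(paddedNeighbors R D x ∩ paddedNeighbors R D y) ≤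
      #G ^ 2 + #G * (2 ^ D + d * Δ * 2 ^ d) := by
  have key : ∀ x ∈ G, ∑ y ∈ G, 2 ^ #(paddedNeighbors R D x ∩ paddedNeighbors R D y) ≤
      #G + (2 ^ D + d * Δ * 2 ^ d) := by
    intro x hx
    have hterm : ∀ y ∈ G, 2 ^ #(paddedNeighbors R D x ∩ paddedNeighbors R D y) ≤
        1 + ((if x = y then 2 ^ D else 0) + ∑ b ∈ R x, if b ∈ R y then 2 ^ d else 0) := by
      intro y hy
      by_cases hxy : x = y
      · subst hxy
        rw [inter_self, card_paddedNeighbors R D x ((hd x hx).trans hD), if_pos rfl]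
        omega
      · rw [card_paddedNeighbors_inter R D hxy, if_neg hxy]
        obtain h | ⟨b, hb⟩ := (R x ∩ R y).eq_empty_or_nonempty
        · rw [h]; simp
        · rw [mem_inter] at hb
          have h1 : (if b ∈ R y then 2 ^ d else 0) ≤ ∑ b ∈ R x, if b ∈ R y then 2 ^ d else 0 :=
            single_le_sum (f := fun b => if b ∈ R y then 2 ^ d else 0)
              (fun _ _ => Nat.zero_le _) hb.1
          rw [if_pos hb.2] at h1
          have h2 : 2 ^ #(R x ∩ R y) ≤ 2 ^ d :=
            Nat.pow_le_pow_right two_pos ((card_le_card inter_subset_left).trans (hd x hx))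
          omega
    refine (sum_le_sum hterm).trans ?_
    rw [sum_add_distrib, sum_add_distrib, sum_comm (s := G)]
    have h3 : ∑ b ∈ R x, ∑ y ∈ G, (if b ∈ R y then 2 ^ d else 0) ≤ d * Δ * 2 ^ d := by
      calc _ ≤ ∑ b ∈ R x, Δ * 2 ^ d := by
            refine sum_le_sum fun b hb => ?_
            rw [← sum_filter, sum_const, smul_eq_mul]
            exact Nat.mul_le_mul_right _ (hΔ x b hb)
        _ ≤ _ := by
            rw [sum_const, smul_eq_mul, mul_assoc]
            exact Nat.mul_le_mul_right _ (hd x hx)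
    simp only [sum_const, smul_eq_mul, mul_one, sum_ite_eq, hx, if_true]
    omega
  refine (sum_le_sum key).trans (le_of_eq ?_)
  rw [sum_const, smul_eq_mul]
  ring

open Finset in
theorem exists_finset_low_degree {α β : Type*} [Fintype α] [DecidableEq α] [DecidableEq β]
    (R : α → Finset β) (d D Δ : ℕ) (hD : d ≤ D) (hΔ : ∀ x, ∀ b ∈ R x, #{y | b ∈ R y} ≤ Δ)
    (hR : 2 * ∑ x, #(R x) ≤ Fintype.card α * (d + 1))
    (hn : 32 * (2 ^ D + d * Δ * 2 ^ d) ≤ Fintype.card α) :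
    ∃ G : Finset α, (∀ x ∈ G, #(R x) ≤ D) ∧ Fintype.card α ≤ 2 * #G ∧
      ∑ x ∈ G, ∑ y ∈ G, (2 : ℝ) ^ #(paddedNeighbors R D x ∩ paddedNeighbors R D y) ≤
        (#G : ℝ) ^ 2 + (#G : ℝ) ^ 2 / 16 := by
  have hG : Fintype.card α ≤ 2 * #{x | #(R x) ≤ d} := by
    have h1 : #{x | ¬ #(R x) ≤ d} * (d + 1) ≤ ∑ x, #(R x) := by
      rw [← smul_eq_mul]
      refine (card_nsmul_le_sum _ (fun x => #(R x)) (d + 1) ?_).trans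
        (sum_le_sum_of_subset (subset_univ _))
      intro x hx
      have := (mem_filter.mp hx).2
      omega
    have h2 : 2 * #{x | ¬ #(R x) ≤ d} ≤ Fintype.card α :=
      Nat.le_of_mul_le_mul_right (by linarith) (Nat.succ_pos d)
    have h3 := card_filter_add_card_filter_not (s := (univ : Finset α)) (fun x => #(R x) ≤ d)
    rw [card_univ] at h3
    omega
  refine ⟨univ.filter fun x => #(R x) ≤ d, fun x hx => (mem_filter.mp hx).2.trans hD, hG, ?_⟩
  have h := sum_two_pow_card_paddedNeighbors_inter_le R (univ.filter fun x => #(R x) ≤ d) d D Δ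
    (fun x hx => (mem_filter.mp hx).2) hD
    (fun x b hb => (card_le_card (filter_subset_filter _ (subset_univ _))).trans (hΔ x b hb))
  have h' : 16 * (2 ^ D + d * Δ * 2 ^ d) ≤ #{x | #(R x) ≤ d} := by omega
  generalize univ.filter (fun x => #(R x) ≤ d) = G at h h' ⊢
  have hr : ∑ x ∈ G, ∑ y ∈ G, (2 : ℝ) ^ #(paddedNeighbors R D x ∩ paddedNeighbors R D y) ≤
      (#G : ℝ) ^ 2 + #G * (2 ^ D + d * Δ * 2 ^ d) := by exact_mod_cast h
  have hr' : 16 * ((2 : ℝ) ^ D + d * Δ * 2 ^ d) ≤ #G := by exact_mod_cast h'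
  nlinarith [Nat.cast_nonneg (α := ℝ) #G]

open Finset in
theorem IsDepthTwoSC.false_of_sparse {n m : ℕ} {E1 : Finset (Fin n × Fin m)}
    {E2 : Finset (Fin m × Fin n)} (hSC : IsDepthTwoSC n m E1 E2) (deg : Fin m → ℕ)
    (hdeg : ∀ v : Fin m, #{e ∈ E1 | e.2 = v} = deg v ∧ #{e ∈ E2 | e.1 = v} = deg v)
    (Med Small Large : Finset (Fin m)) (hcover : ∀ v, v ∈ Med ∨ v ∈ Small ∨ v ∈ Large)
    (k d D Δ : ℕ) (hk : 0 < k) (hkn : k ≤ n) (hD : d ≤ D) (hΔ : ∀ v ∈ Med, deg v ≤ Δ)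
    (hE1 : 2 * #{e ∈ E1 | e.2 ∈ Med} ≤ n * (d + 1))
    (hE2 : 2 * #{e ∈ E2 | e.1 ∈ Med} ≤ n * (d + 1))
    (hn : 32 * (2 ^ D + d * Δ * 2 ^ d) ≤ n) (hnk : 4 * k * 2 ^ D ≤ n)
    (hlarge : (#Large : ℝ) ≤ k / 4)
    (hsmall : ∑ v ∈ Small, (deg v : ℝ) ^ 2 ≤ (2 ^ D) ^ 2 * (k / 16)) : False := by
  set R : Fin n → Finset (Fin m) := fun x => {v ∈ Med | (x, v) ∈ E1} with hR
  set R' : Fin n → Finset (Fin m) := fun y => {v ∈ Med | (v, y) ∈ E2} with hR'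
  have hsumR : ∑ x, #(R x) = #{e ∈ E1 | e.2 ∈ Med} := by
    rw [card_eq_sum_card_fiberwise (f := Prod.fst) (t := univ) (fun _ _ => by simp)]
    refine sum_congr rfl fun x _ => ?_
    refine card_bij' (fun v _ => (x, v)) (fun e _ => e.2) ?_ ?_ ?_ ?_ <;> simp [hR] <;> grind
  have hsumR' : ∑ y, #(R' y) = #{e ∈ E2 | e.1 ∈ Med} := by
    rw [card_eq_sum_card_fiberwise (f := Prod.snd) (t := univ) (fun _ _ => by simp)]
    refine sum_congr rfl fun y _ => ?_
    refine card_bij' (fun v _ => (v, y)) (fun e _ => e.1) ?_ ?_ ?_ ?_ <;> simp [hR'] <;> grind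
  obtain ⟨G, hGD, hGn, hG⟩ := exists_finset_low_degree R d D Δ hD (by
    intro x b hb
    have hb' : b ∈ Med := (mem_filter.mp hb).1
    refine le_trans ?_ (hΔ b hb')
    rw [← (hdeg b).1]
    refine card_le_card_of_injOn (fun y => (y, b)) ?_ ?_
    · intro y hy
      simp [hR] at hy ⊢
      exact hy.2
    · intro y _ z _ h
      exact (Prod.mk.inj h).1) (by rw [hsumR, Fintype.card_fin]; exact hE1)
    (by rw [Fintype.card_fin]; exact hn)
  obtain ⟨H, hHD, hHn, hH⟩ := exists_finset_low_degree R' d D Δ hD (by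
    intro x b hb
    have hb' : b ∈ Med := (mem_filter.mp hb).1
    refine le_trans ?_ (hΔ b hb')
    rw [← (hdeg b).2]
    refine card_le_card_of_injOn (fun y => (b, y)) ?_ ?_
    · intro y hy
      simp [hR'] at hy ⊢
      exact hy.2
    · intro y _ z _ h
      exact (Prod.mk.inj h).2) (by rw [hsumR', Fintype.card_fin]; exact hE2)
    (by rw [Fintype.card_fin]; exact hn)
  rw [Fintype.card_fin] at hGn hHn
  set T : Finset (Fin m × Fin n × Fin n) := {t | t.1 ∈ Small ∧ (t.2.1, t.1) ∈ E1 ∧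
    (t.1, t.2.2) ∈ E2 ∧ t.2.1 ∈ G ∧ t.2.2 ∈ H} with hTdef
  have hT : #T ≤ ∑ v ∈ Small, deg v ^ 2 := by
    rw [card_eq_sum_card_fiberwise (f := Prod.fst) (t := Small) (fun t ht => by
      simp [hTdef] at ht ⊢; exact ht.1)]
    refine sum_le_sum fun v _ => ?_
    have h : deg v ^ 2 = #({e ∈ E1 | e.2 = v} ×ˢ {e ∈ E2 | e.1 = v}) := by
      rw [card_product, (hdeg v).1, (hdeg v).2, sq]
    rw [h]
    refine card_le_card_of_injOn (fun t => ((t.2.1, t.1), (t.1, t.2.2))) ?_ ?_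
    · rintro ⟨v', x, y⟩ ht
      simp [hTdef] at ht ⊢
      grind
    · rintro ⟨v', x, y⟩ _ ⟨v'', x', y'⟩ _ h
      simp at h ⊢
      grind
  have hT' : (#T : ℝ) ≤ (2 ^ D) ^ 2 * (k / 16) := by
    refine le_trans ?_ hsmall
    exact_mod_cast hT
  obtain ⟨ω, hωG, hωH, hωT⟩ := exists_finset_many_subset G H (paddedNeighbors R D)
    (paddedNeighbors R' D) D (fun x hx => card_paddedNeighbors R D x (hGD x hx))
    (fun x hx => card_paddedNeighbors R' D x (hHD x hx)) hG hH T (fun t => t.2.1)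
    (fun t => t.2.2) (by simp [hTdef]; tauto) (by simp [hTdef]) k hk
    (by have : 2 * k * 2 ^ D ≤ #G := by linarith
        exact_mod_cast this)
    (by have : 2 * k * 2 ^ D ≤ #H := by linarith
        exact_mod_cast this) hT'
  obtain ⟨S, hS, hSk⟩ := exists_subset_card_eq hωG
  obtain ⟨S', hS', hSk'⟩ := exists_subset_card_eq hωH
  obtain ⟨vs, ms, ws, -, hms, -, hpath⟩ := hSC k hk hkn S S' hSk hSk'
  have hmem : ∀ j, ms j ∈ Large ∨ ms j ∈ Small := by
    intro j
    obtain ⟨hv, hw, he1, he2⟩ := hpath j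
    rcases hcover (ms j) with h | h | h
    · exfalso
      have h1 := (mem_filter.mp (hS hv)).2
      have h2 := (mem_filter.mp (hS' hw)).2
      have m1 : Sum.inl (ms j) ∈ ω := h1 (by simp [paddedNeighbors, hR, h, he1])
      have m2 : Sum.inl (ms j) ∈ ωᶜ := h2 (by simp [paddedNeighbors, hR', h, he2])
      exact (mem_compl.mp m2) m1
    · exact .inr h
    · exact .inl h
  have c1 : #{j | ms j ∈ Large} ≤ #Large :=
    card_le_card_of_injOn ms (fun j hj => by simpa using hj) hms.injOn
  have c2 : #{j | ¬ ms j ∈ Large} ≤ #{t ∈ T | paddedNeighbors R D t.2.1 ⊆ ω ∧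
      paddedNeighbors R' D t.2.2 ⊆ ωᶜ} := by
    refine card_le_card_of_injOn (fun j => (ms j, vs j, ws j)) ?_ ?_
    · intro j hj
      have hj' : ms j ∉ Large := by simpa using hj
      obtain ⟨hv, hw, he1, he2⟩ := hpath j
      have h1 := mem_filter.mp (hS hv)
      have h2 := mem_filter.mp (hS' hw)
      simp [hTdef, he1, he2, h1, h2, (hmem j).resolve_left hj']
    · intro i _ j _ h
      exact hms (Prod.mk.inj h).1
  have c3 := card_filter_add_card_filter_not (s := (univ : Finset (Fin k))) (fun j => ms j ∈ Large)
  rw [card_univ, Fintype.card_fin] at c3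
  have c4 : (k : ℝ) ≤ #Large + #{t ∈ T | paddedNeighbors R D t.2.1 ⊆ ω ∧
      paddedNeighbors R' D t.2.2 ⊆ ωᶜ} := by
    have := c3.symm.le.trans (Nat.add_le_add c1 c2)
    exact_mod_cast this
  have hk' : (0 : ℝ) < k := by exact_mod_cast hk
  linarith

open Filter in
theorem eventually_log_growth : ∀ᶠ n : ℕ in atTop,
    16 ≤ (n : ℝ) ^ ((1 : ℝ) / 8) ∧ 8 * Real.log n ^ 3 ≤ (n : ℝ) ^ ((1 : ℝ) / 8) ∧
      1 ≤ Real.log n ∧ 1 ≤ Real.log (Real.log n) := by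
  refine tendsto_natCast_atTop_atTop.eventually (p := fun x : ℝ =>
    16 ≤ x ^ ((1 : ℝ) / 8) ∧ 8 * Real.log x ^ 3 ≤ x ^ ((1 : ℝ) / 8) ∧
      1 ≤ Real.log x ∧ 1 ≤ Real.log (Real.log x)) ?_
  have h1 := (tendsto_rpow_atTop (show (0 : ℝ) < 1 / 8 by norm_num)).eventually_ge_atTop 16
  have h2 := (isLittleO_log_rpow_rpow_atTop 3 (show (0 : ℝ) < 1 / 8 by norm_num)).bound
    (show (0 : ℝ) < 1 / 8 by norm_num)
  have h3 := Real.tendsto_log_atTop.eventually_ge_atTop 1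
  have h4 := (Real.tendsto_log_atTop.comp Real.tendsto_log_atTop).eventually_ge_atTop 1
  filter_upwards [h1, h2, h3, h4] with x h1 h2 h3 h4
  refine ⟨h1, ?_, h3, h4⟩
  have h5 : Real.log x ^ (3 : ℝ) = Real.log x ^ 3 := by exact_mod_cast Real.rpow_natCast _ 3
  rw [h5, Real.norm_of_nonneg (by positivity), Real.norm_of_nonneg (by linarith)] at h2
  linarith

/-- Key claim in the superconcentrator lower bound: there exist `c, c' > 0` such
that for all sufficiently large `n`, if `G = (V, M, W, E)` is a depth-two
`n`-superconcentrator in which every middle vertex `v` has the same number `deg v`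
of edges coming from `V` as going to `W`, and `|E| ≤ c' · n · (log n)² / log log n`,
then for every `k` with `n^(1/4) ≤ k ≤ n^(3/4)`, the number of edges incident on
`Medium(k) = { v ∈ M : (n/k)(log n)⁻² ≤ deg v < (n/k)(log n)² }` is at least
`c · n · log n`. -/
theorem stmt_12 :
    ∃ c c' : ℝ, c > 0 ∧ c' > 0 ∧ ∃ N : ℕ, ∀ n : ℕ, N ≤ n →
      ∀ m : ℕ, ∀ E1 : Finset (Fin n × Fin m), ∀ E2 : Finset (Fin m × Fin n),
      ∀ deg : Fin m → ℕ,
      IsDepthTwoSC n m E1 E2 →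
      (∀ v : Fin m, (E1.filter (fun e => e.2 = v)).card = deg v ∧
                    (E2.filter (fun e => e.1 = v)).card = deg v) →
      ((E1.card + E2.card : ℕ) : ℝ) ≤
        c' * (n : ℝ) * (Real.log n) ^ 2 / Real.log (Real.log n) →
      ∀ k : ℕ, (n : ℝ) ^ ((1 : ℝ) / 4) ≤ (k : ℝ) → (k : ℝ) ≤ (n : ℝ) ^ ((3 : ℝ) / 4) →
      ∀ Med : Finset (Fin m),
      (∀ v : Fin m, v ∈ Med ↔
          ((n : ℝ) / k) * ((Real.log n) ^ 2)⁻¹ ≤ (deg v : ℝ) ∧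
          (deg v : ℝ) < ((n : ℝ) / k) * (Real.log n) ^ 2) →
      (((E1.filter (fun e => e.2 ∈ Med)).card +
          (E2.filter (fun e => e.1 ∈ Med)).card : ℕ) : ℝ) ≥
        c * (n : ℝ) * Real.log n := by
  obtain ⟨N, hN⟩ := Filter.eventually_atTop.mp eventually_log_growth
  refine ⟨1 / 16, 1 / 1024, by norm_num, by norm_num, N, ?_⟩
  intro n hn m E1 E2 deg hSC hdeg hE k hk1 hk2 Med hMed
  by_contra! hlt
  obtain ⟨hs, hLs, hL, hLL⟩ := hN n hn
  have hn0 : (0 : ℝ) ≤ n := Nat.cast_nonneg n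
  have hpow : ∀ i : ℕ, (n : ℝ) ^ ((i : ℝ) / 8) = ((n : ℝ) ^ ((1 : ℝ) / 8)) ^ i := by
    intro i
    rw [← Real.rpow_mul_natCast hn0]
    congr 1
    ring
  have hs2 : (n : ℝ) ^ ((1 : ℝ) / 4) = ((n : ℝ) ^ ((1 : ℝ) / 8)) ^ 2 := by
    rw [← hpow]; norm_num
  have hs6 : (n : ℝ) ^ ((3 : ℝ) / 4) = ((n : ℝ) ^ ((1 : ℝ) / 8)) ^ 6 := by
    rw [← hpow]; norm_num
  have hs8 : (n : ℝ) = ((n : ℝ) ^ ((1 : ℝ) / 8)) ^ 8 := by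
    rw [← hpow]; norm_num
  have hexp : Real.exp (Real.log n / 8) = (n : ℝ) ^ ((1 : ℝ) / 8) := by
    have hnpos : (0 : ℝ) < n := by
      rcases hn0.eq_or_lt with h | h
      · rw [← h, Real.log_zero] at hL
        linarith
      · exact h
    rw [Real.rpow_def_of_pos hnpos]
    congr 1
    ring
  rw [hs2] at hk1
  rw [hs6] at hk2
  set s : ℝ := (n : ℝ) ^ ((1 : ℝ) / 8)
  set L : ℝ := Real.log n
  have hs0 : 0 < s := by linarith
  have hnpos : (0 : ℝ) < n := by rw [hs8]; positivity
  have hkpos : (0 : ℝ) < k := lt_of_lt_of_le (by positivity) hk1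
  have hL0 : 0 < L := by linarith
  have hs256 : (256 : ℝ) ≤ s ^ 2 := by nlinarith
  have hk256 : (256 : ℝ) ≤ k := hs256.trans hk1
  have hkn2 : s ^ 2 * k ≤ n := by
    calc s ^ 2 * k ≤ s ^ 2 * s ^ 6 := by gcongr
      _ = (n : ℝ) := by rw [← pow_add]; exact hs8.symm
  have hkn256 : 256 * (k : ℝ) ≤ n :=
    (mul_le_mul_of_nonneg_right hs256 hkpos.le).trans hkn2
  have hkn : (k : ℝ) ≤ n := by linarith
  have hE' : ((E1.card : ℝ) + E2.card) ≤ 1 / 1024 * n * L ^ 2 := by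
    rw [Nat.cast_add] at hE
    exact hE.trans (div_le_self (by positivity) hLL)
  have hsumdeg : ∀ P : Finset (Fin m), ∑ v ∈ P, (deg v : ℝ) ≤ 1 / 1024 * n * L ^ 2 := by
    intro P
    have h1 : ∑ v ∈ P, deg v ≤ E1.card := by
      rw [Finset.card_eq_sum_card_fiberwise (f := Prod.snd) (t := Finset.univ)
        (fun _ _ => by simp)]
      refine (Finset.sum_le_sum_of_subset (Finset.subset_univ P)).trans (le_of_eq ?_)
      exact Finset.sum_congr rfl fun v _ => (hdeg v).1.symm
    have h2 : ∑ v ∈ P, (deg v : ℝ) ≤ E1.card := by exact_mod_cast h1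
    have h3 : (0 : ℝ) ≤ E2.card := Nat.cast_nonneg _
    linarith
  obtain ⟨D, hD1, hD2⟩ := exists_nat_pow_near (x := (n : ℝ) / (4 * k)) (y := 2)
    (by rw [le_div_iff₀ (by positivity)]; linarith) one_lt_two
  rw [le_div_iff₀ (by positivity)] at hD1
  rw [div_lt_iff₀ (by positivity), pow_succ] at hD2
  set d : ℕ := ⌊L / 8⌋₊
  have hd1 : (d : ℝ) ≤ L / 8 := Nat.floor_le (by positivity)
  have hd2 : L / 8 < d + 1 := Nat.lt_floor_add_one _
  have h2d : (2 : ℝ) ^ d ≤ s := by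
    rw [← hexp]
    calc (2 : ℝ) ^ d ≤ Real.exp 1 ^ d := by
          gcongr
          linarith [Real.add_one_le_exp 1]
      _ = Real.exp d := by rw [← Real.exp_nat_mul, mul_one]
      _ ≤ _ := Real.exp_le_exp.mpr hd1
  have hdD : d ≤ D := by
    have h1 : s ^ 2 < 8 * 2 ^ D := by
      have : s ^ 2 * k < 8 * 2 ^ D * k := by linarith
      exact lt_of_mul_lt_mul_right this hkpos.le
    have h2 : (2 : ℝ) ^ d < 2 ^ D := by
      linarith [mul_le_mul_of_nonneg_right hs hs0.le, sq s]
    exact ((pow_lt_pow_iff_right₀ one_lt_two).mp h2).le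
  set Δ : ℕ := ⌊(n : ℝ) / k * L ^ 2⌋₊
  have hΔ1 : (Δ : ℝ) ≤ n / k * L ^ 2 := Nat.floor_le (by positivity)
  rw [Nat.cast_add] at hlt
  have hM1 : (0 : ℝ) ≤ (E1.filter (fun e => e.2 ∈ Med)).card := Nat.cast_nonneg _
  have hM2 : (0 : ℝ) ≤ (E2.filter (fun e => e.1 ∈ Med)).card := Nat.cast_nonneg _
  have hnd : 1 / 8 * n * L ≤ n * ((d : ℝ) + 1) := by
    linarith [mul_le_mul_of_nonneg_left hd2.le hn0]
  refine hSC.false_of_sparse deg hdeg Med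
    (Finset.univ.filter fun v => (deg v : ℝ) < n / k * (L ^ 2)⁻¹)
    (Finset.univ.filter fun v => (n : ℝ) / k * L ^ 2 ≤ deg v) ?_ k d D Δ
    (by exact_mod_cast hkpos) (by exact_mod_cast hkn) hdD ?_ ?_ ?_ ?_ ?_ ?_ ?_
  · intro v
    simp only [hMed, Finset.mem_filter, Finset.mem_univ, true_and]
    grind
  · intro v hv
    exact Nat.le_floor ((hMed v).mp hv).2.le
  · have : 2 * ((E1.filter (fun e => e.2 ∈ Med)).card : ℝ) ≤ n * ((d : ℝ) + 1) := by linarith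
    exact_mod_cast this
  · have : 2 * ((E2.filter (fun e => e.1 ∈ Med)).card : ℝ) ≤ n * ((d : ℝ) + 1) := by linarith
    exact_mod_cast this
  · have h1 : (2 : ℝ) ^ D ≤ n / 64 := by
      have : (256 : ℝ) * 2 ^ D ≤ k * 2 ^ D := mul_le_mul_of_nonneg_right hk256 (by positivity)
      linarith [show (0 : ℝ) < 2 ^ D by positivity]
    have h2 : (d : ℝ) * Δ * 2 ^ d ≤ n / 64 := by
      calc (d : ℝ) * Δ * 2 ^ d ≤ L / 8 * (n / k * L ^ 2) * s := by gcongr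
        _ = n * (8 * L ^ 3 * s) / (64 * k) := by field_simp; norm_num
        _ ≤ n * k / (64 * k) := by
          gcongr
          exact (mul_le_mul_of_nonneg_right hLs hs0.le).trans ((sq s).symm.le.trans hk1)
        _ = n / 64 := by field_simp
    have : 32 * ((2 : ℝ) ^ D + d * Δ * 2 ^ d) ≤ n := by linarith
    exact_mod_cast this
  · have : 4 * (k : ℝ) * 2 ^ D ≤ n := by linarith
    exact_mod_cast this
  · have h := hsumdeg (Finset.univ.filter fun v => (n : ℝ) / k * L ^ 2 ≤ deg v)
    have h' := Finset.card_nsmul_le_sum (Finset.univ.filter fun v => (n : ℝ) / k * L ^ 2 ≤ deg v)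
      (fun v => (deg v : ℝ)) (n / k * L ^ 2) (fun v hv => (Finset.mem_filter.mp hv).2)
    rw [nsmul_eq_mul] at h'
    have h3 := h'.trans h
    have h4 : (0 : ℝ) < n / k * L ^ 2 := by positivity
    refine le_of_mul_le_mul_right (h3.trans ?_) h4
    have h5 : (k : ℝ) / 4 * (n / k * L ^ 2) = 1 / 4 * n * L ^ 2 := by field_simp
    rw [h5]
    gcongr
    norm_num
  · calc ∑ v ∈ Finset.univ.filter (fun v => (deg v : ℝ) < n / k * (L ^ 2)⁻¹), (deg v : ℝ) ^ 2
        ≤ ∑ v ∈ Finset.univ.filter (fun v => (deg v : ℝ) < n / k * (L ^ 2)⁻¹),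
            n / k * (L ^ 2)⁻¹ * (deg v : ℝ) := by
          refine Finset.sum_le_sum fun v hv => ?_
          rw [sq]
          exact mul_le_mul_of_nonneg_right (Finset.mem_filter.mp hv).2.le (Nat.cast_nonneg _)
      _ ≤ n / k * (L ^ 2)⁻¹ * (1 / 1024 * n * L ^ 2) := by
          rw [← Finset.mul_sum]
          gcongr
          exact hsumdeg _
      _ = (n / (8 * k)) ^ 2 * (k / 16) := by field_simp; norm_num
      _ ≤ (2 ^ D) ^ 2 * (k / 16) := by
          gcongr
          rw [div_le_iff₀ (by positivity)]
          linarith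
end
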